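/- arXiv:1905.09445 — 6 statements merged into one kernel-verified Lean document; each statement's English description precedes it below -/
import Mathlib

section
/- Let n ≥ 2, μ > 0 and β > 2. Then there exists a C² function φ : ℝⁿ → ℝ and a constant C > 0 such that Δφ(x) − (μ/(1+|x|)^β) φ(x) = φ(x) for every x ∈ ℝⁿ, and 0 < φ(x) ≤ C (1+|x|)^{−(n−1)/2} e^{|x|} for every x ∈ ℝⁿ. -/
open MeasureTheory Real Set

/-- The Laplacian of a function on Euclidean space, as the sum of second partial
derivatives in the coordinate directions. -/
noncomputable def laplacian {n : ℕ} (f : EuclideanSpace ℝ (Fin n) → ℝ)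
    (x : EuclideanSpace ℝ (Fin n)) : ℝ :=
  ∑ i : Fin n,
    fderiv ℝ (fun y => fderiv ℝ f y (EuclideanSpace.single i 1)) x (EuclideanSpace.single i 1)

/-- The integral `∫₀¹ τ ^ m f (s τ) dτ`. For `s > 0` it equals
`s ^ (-(m + 1)) ∫₀ˢ t ^ m f t dt`, so `s * radialMean m f s` is the radial derivative of the
regular radial solution of `Δφ = f (‖x‖)` in dimension `m + 1`. -/
noncomputable def radialMean (m : ℕ) (f : ℝ → ℝ) (s : ℝ) : ℝ :=
  ∫ τ in (0 : ℝ)..1, τ ^ m * f (s * τ)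

theorem continuous_radialMean (m : ℕ) {f : ℝ → ℝ} (hf : Continuous f) :
    Continuous (radialMean m f) := by
  unfold radialMean
  apply intervalIntegral.continuous_parametric_intervalIntegral_of_continuous'
  fun_prop

theorem radialMean_zero (m : ℕ) (f : ℝ → ℝ) : radialMean m f 0 = f 0 / (m + 1) := by
  simp [radialMean, integral_pow]
  ring

theorem pow_mul_radialMean (m : ℕ) (f : ℝ → ℝ) (s : ℝ) :
    s ^ (m + 1) * radialMean m f s = ∫ t in (0 : ℝ)..s, t ^ m * f t := by
  have h := intervalIntegral.smul_integral_comp_mul_left (a := 0) (b := 1)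
    (fun t => t ^ m * f t) s
  simp only [mul_zero, mul_one, smul_eq_mul] at h
  rw [← h, pow_succ', mul_assoc, radialMean, ← intervalIntegral.integral_const_mul]
  congr 2
  ext τ
  ring

theorem hasDerivAt_radialMean (m : ℕ) {f : ℝ → ℝ} (hf : Continuous f) {s : ℝ} (hs : 0 < s) :
    HasDerivAt (radialMean m f) ((f s - (m + 1) * radialMean m f s) / s) s := by
  have hcont : Continuous fun t : ℝ => t ^ m * f t := by fun_prop
  have hI := (hcont.integral_hasStrictDerivAt 0 s).hasDerivAt
  have hpow : s ^ (m + 1) ≠ 0 := by positivity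
  have hq := hI.div (hasDerivAt_pow (m + 1) s) hpow
  have hev : radialMean m f =ᶠ[nhds s]
      (fun u => ∫ t in (0 : ℝ)..u, t ^ m * f t) / fun u => u ^ (m + 1) := by
    filter_upwards [lt_mem_nhds hs] with u hu
    have hu' : u ^ (m + 1) ≠ 0 := by positivity
    rw [Pi.div_apply, eq_div_iff hu', mul_comm, pow_mul_radialMean]
  refine (hq.congr_of_eventuallyEq hev).congr_deriv ?_
  simp only [← pow_mul_radialMean, Nat.add_sub_cancel, Nat.cast_add, Nat.cast_one]
  field_simp
  ring

section Gradient

variable {E : Type*} [NormedAddCommGroup E] [InnerProductSpace ℝ E]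

theorem hasFDerivAt_norm_of_ne_zero {x : E} (hx : x ≠ 0) :
    HasFDerivAt (fun y : E => ‖y‖) (‖x‖⁻¹ • innerSL ℝ x) x := by
  have h := ((hasStrictFDerivAt_norm_sq x).hasFDerivAt).sqrt (by simpa using hx)
  have hx' : ‖x‖ ≠ 0 := by simpa using hx
  simp only [Real.sqrt_sq (norm_nonneg _)] at h
  convert h using 1
  ext y
  simp
  field_simp

/-- The derivative of the radial vector field `x ↦ w ‖x‖ • x`, where `w = radialMean m f`. -/
noncomputable def radialHessian (m : ℕ) (f : ℝ → ℝ) (x : E) : E →L[ℝ] E :=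
  radialMean m f ‖x‖ • ContinuousLinearMap.id ℝ E +
    ((‖x‖ ^ 2)⁻¹ * (f ‖x‖ - (m + 1) * radialMean m f ‖x‖)) • (innerSL ℝ x).smulRight x

theorem hasFDerivAt_radialMean_smul (m : ℕ) {f : ℝ → ℝ} (hf : Continuous f) (x : E) :
    HasFDerivAt (fun y : E => radialMean m f ‖y‖ • y) (radialHessian m f x) x := by
  by_cases hx : x = 0
  · subst hx
    rw [hasFDerivAt_iff_isLittleO_nhds_zero]
    have ht : Filter.Tendsto (fun h : E => radialMean m f ‖h‖ - radialMean m f 0)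
        (nhds 0) (nhds 0) := by
      have : Continuous fun h : E => radialMean m f ‖h‖ - radialMean m f 0 :=
        ((continuous_radialMean m hf).comp continuous_norm).sub continuous_const
      simpa using this.tendsto 0
    have := ((Asymptotics.isLittleO_one_iff ℝ).2 ht).smul_isBigO
      (Asymptotics.isBigO_refl (fun h : E => h) (nhds 0))
    simpa [radialHessian, sub_smul] using this
  · have hpos : 0 < ‖x‖ := norm_pos_iff.2 hx
    have h1 := (hasDerivAt_radialMean m hf hpos).comp_hasFDerivAt x
      (hasFDerivAt_norm_of_ne_zero hx)
    refine (h1.smul (hasFDerivAt_id x)).congr_fderiv ?_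
    ext y
    simp only [radialHessian, Function.comp_apply, id, add_apply,
      smul_apply, ContinuousLinearMap.smulRight_apply,
      ContinuousLinearMap.id_apply, innerSL_apply_apply, smul_smul, smul_eq_mul]
    congr 2
    field_simp

theorem continuous_radialHessian (m : ℕ) {f : ℝ → ℝ} (hf : Continuous f) :
    Continuous (radialHessian m f : E → E →L[ℝ] E) := by
  have hw : Continuous fun x : E => radialMean m f ‖x‖ :=
    (continuous_radialMean m hf).comp continuous_norm
  have hd : Continuous fun x : E => f ‖x‖ - (m + 1) * radialMean m f ‖x‖ := by fun_prop
  have hsr : Continuous fun x : E => (innerSL ℝ x).smulRight x := by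
    have h2 : Continuous fun x : E => ContinuousLinearMap.smulRightL ℝ E E (innerSL ℝ x) x := by
      fun_prop
    exact h2
  unfold radialHessian
  refine (hw.smul continuous_const).add (continuous_iff_continuousAt.2 fun x => ?_)
  by_cases hx : x = 0
  · subst hx
    have hlim : Filter.Tendsto (fun x : E => |f ‖x‖ - (m + 1) * radialMean m f ‖x‖|)
        (nhds 0) (nhds 0) := by
      have h0 := hd.abs.tendsto 0
      rw [norm_zero, radialMean_zero, mul_div_cancel₀ _ (by positivity : (m : ℝ) + 1 ≠ 0),
        sub_self, abs_zero] at h0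
      exact h0
    rw [ContinuousAt]
    simp only [map_zero, ContinuousLinearMap.smulRight_zero, smul_zero]
    refine squeeze_zero_norm (fun x => ?_) hlim
    rw [norm_smul, ContinuousLinearMap.norm_smulRight_apply, innerSL_apply_norm, norm_mul,
      Real.norm_eq_abs (_ - _), norm_inv, norm_pow, norm_norm]
    by_cases hx : ‖x‖ = 0
    · simp [hx]
    · apply le_of_eq
      field_simp
  · have hx' : ‖x‖ ^ 2 ≠ 0 := by simpa using hx
    have hn : ContinuousAt (fun x : E => (‖x‖ ^ 2)⁻¹) x :=
      (continuous_norm.pow 2).continuousAt.inv₀ hx'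
    exact (hn.mul hd.continuousAt).smul hsr.continuousAt

theorem contDiff_radialMean_smul (m : ℕ) {f : ℝ → ℝ} (hf : Continuous f) :
    ContDiff ℝ 1 fun y : E => radialMean m f ‖y‖ • y := by
  rw [contDiff_one_iff_fderiv]
  refine ⟨fun x => (hasFDerivAt_radialMean_smul m hf x).differentiableAt, ?_⟩
  rw [funext fun x : E => (hasFDerivAt_radialMean_smul m hf x).fderiv]
  exact continuous_radialHessian m hf

/-- The regular radial potential `c + ∫₀ʳ s * radialMean m f s ds`. -/
noncomputable def radialPotential (m : ℕ) (f : ℝ → ℝ) (c r : ℝ) : ℝ :=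
  c + ∫ s in (0 : ℝ)..r, s * radialMean m f s

theorem hasDerivAt_radialPotential (m : ℕ) {f : ℝ → ℝ} (hf : Continuous f) (c r : ℝ) :
    HasDerivAt (radialPotential m f c) (r * radialMean m f r) r := by
  have hcont : Continuous fun s => s * radialMean m f s :=
    continuous_id.mul (continuous_radialMean m hf)
  exact ((hcont.integral_hasStrictDerivAt 0 r).hasDerivAt).const_add c

theorem hasFDerivAt_radialPotential_norm (m : ℕ) {f : ℝ → ℝ} (hf : Continuous f) (c : ℝ) (x : E) :
    HasFDerivAt (fun y : E => radialPotential m f c ‖y‖)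
      (innerSL ℝ (radialMean m f ‖x‖ • x)) x := by
  have hU := hasDerivAt_radialPotential m hf c ‖x‖
  by_cases hx : x = 0
  · subst hx
    rw [norm_zero, zero_mul] at hU
    rw [hasDerivAt_iff_isLittleO_nhds_zero] at hU
    rw [hasFDerivAt_iff_isLittleO_nhds_zero]
    have ht : Filter.Tendsto (fun h : E => ‖h‖) (nhds 0) (nhds 0) := by
      simpa using continuous_norm.tendsto (0 : E)
    simpa [Function.comp_def] using Asymptotics.isLittleO_norm_right.1 (hU.comp_tendsto ht)
  · have hx' : ‖x‖ ≠ 0 := by simpa using hx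
    refine (hU.comp_hasFDerivAt x (hasFDerivAt_norm_of_ne_zero hx)).congr_fderiv ?_
    rw [smul_smul, map_smul]
    congr 1
    field_simp

theorem contDiff_radialPotential_norm (m : ℕ) {f : ℝ → ℝ} (hf : Continuous f) (c : ℝ) :
    ContDiff ℝ 2 fun y : E => radialPotential m f c ‖y‖ := by
  rw [show (2 : WithTop ℕ∞) = 1 + 1 by norm_num, contDiff_succ_iff_fderiv]
  refine ⟨fun x => (hasFDerivAt_radialPotential_norm m hf c x).differentiableAt, by simp, ?_⟩
  rw [funext fun x : E => (hasFDerivAt_radialPotential_norm m hf c x).fderiv]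
  exact (innerSL ℝ).contDiff.comp (contDiff_radialMean_smul m hf)

end Gradient

theorem laplacian_radialPotential_norm (m : ℕ) {f : ℝ → ℝ} (hf : Continuous f) (c : ℝ)
    (x : EuclideanSpace ℝ (Fin (m + 1))) :
    laplacian (fun y => radialPotential m f c ‖y‖) x = f ‖x‖ := by
  have hterm (i : Fin (m + 1)) :
      fderiv ℝ (fun y => fderiv ℝ (fun y => radialPotential m f c ‖y‖) y
        (EuclideanSpace.single i 1)) x (EuclideanSpace.single i 1) =
      radialMean m f ‖x‖ +
        (‖x‖ ^ 2)⁻¹ * (f ‖x‖ - (m + 1) * radialMean m f ‖x‖) * x i ^ 2 := by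
    have h1 : (fun y => fderiv ℝ (fun y => radialPotential m f c ‖y‖) y
        (EuclideanSpace.single i 1)) =
        fun y : EuclideanSpace ℝ (Fin (m + 1)) =>
          innerSL ℝ (EuclideanSpace.single i (1 : ℝ)) (radialMean m f ‖y‖ • y) := by
      ext y
      rw [(hasFDerivAt_radialPotential_norm m hf c y).fderiv, innerSL_apply_apply,
        innerSL_apply_apply, real_inner_comm]
    have h2 : HasFDerivAt (fun y => innerSL ℝ (EuclideanSpace.single i (1 : ℝ))
        (radialMean m f ‖y‖ • y))
        ((innerSL ℝ (EuclideanSpace.single i (1 : ℝ))).comp (radialHessian m f x)) x :=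
      (innerSL ℝ (EuclideanSpace.single i (1 : ℝ))).hasFDerivAt.comp x
        (hasFDerivAt_radialMean_smul m hf x)
    rw [h1, h2.fderiv]
    simp [radialHessian, EuclideanSpace.inner_single_left, EuclideanSpace.inner_single_right,
      -mul_eq_mul_left_iff]
    ring
  unfold laplacian
  rw [Finset.sum_congr rfl fun i _ => hterm i, Finset.sum_add_distrib, ← Finset.mul_sum,
    ← EuclideanSpace.real_norm_sq_eq]
  simp only [Finset.sum_const, Finset.card_univ, Fintype.card_fin, nsmul_eq_mul]
  by_cases hx : ‖x‖ = 0
  · rw [hx, radialMean_zero]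
    push_cast
    field_simp
    ring
  · push_cast
    field_simp
    ring

theorem radialMean_mono (m : ℕ) {f g : ℝ → ℝ} (hf : Continuous f) (hg : Continuous g)
    (hfg : ∀ t, 0 ≤ t → f t ≤ g t) {s : ℝ} (hs : 0 ≤ s) :
    radialMean m f s ≤ radialMean m g s := by
  refine intervalIntegral.integral_mono_on zero_le_one
    (Continuous.intervalIntegrable (by fun_prop) _ _)
    (Continuous.intervalIntegrable (by fun_prop) _ _) fun τ hτ => ?_
  exact mul_le_mul_of_nonneg_left (hfg _ (mul_nonneg hs hτ.1)) (pow_nonneg hτ.1 m)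

theorem radialMean_nonneg (m : ℕ) {f : ℝ → ℝ} (hf : ∀ t, 0 ≤ t → 0 ≤ f t) {s : ℝ} (hs : 0 ≤ s) :
    0 ≤ radialMean m f s :=
  intervalIntegral.integral_nonneg zero_le_one fun _ hτ =>
    mul_nonneg (pow_nonneg hτ.1 m) (hf _ (mul_nonneg hs hτ.1))

/-- If `g' + (m / t) g ≥ f` on `(0, ∞)`, then `g r ≥ r * radialMean m f r`. -/
theorem mul_radialMean_le {m : ℕ} (hm : m ≠ 0) {f g g' : ℝ → ℝ} (hf : Continuous f)
    (hg : Continuous g) (hg' : ∀ t, 0 < t → HasDerivAt g (g' t) t)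
    (hfg : ∀ t, 0 < t → f t ≤ g' t + m / t * g t) {r : ℝ} (hr : 0 < r) :
    r * radialMean m f r ≤ g r := by
  have hderiv (τ : ℝ) (hτ : 0 < τ) : HasDerivAt (fun τ => τ ^ m * g (r * τ))
      (m * τ ^ (m - 1) * g (r * τ) + τ ^ m * (g' (r * τ) * r)) τ := by
    have hlin : HasDerivAt (fun τ : ℝ => r * τ) r τ := by
      simpa using (hasDerivAt_id τ).const_mul r
    exact (hasDerivAt_pow m τ).mul ((hg' (r * τ) (mul_pos hr hτ)).comp τ hlin)
  have hcont : Continuous fun τ => r * (τ ^ m * f (r * τ)) := by fun_prop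
  have h := intervalIntegral.integral_le_sub_of_hasDeriv_right_of_le (zero_le_one (α := ℝ))
    (g := fun τ => τ ^ m * g (r * τ)) (φ := fun τ => r * (τ ^ m * f (r * τ)))
    (by fun_prop) (fun τ hτ => (hderiv τ hτ.1).hasDerivWithinAt)
    (hcont.continuousOn.integrableOn_compact isCompact_Icc) fun τ hτ => by
      have hτ0 : 0 < τ := hτ.1
      have hτm : 0 ≤ r * τ ^ m := by positivity
      have hle := mul_le_mul_of_nonneg_left (hfg (r * τ) (mul_pos hr hτ0)) hτm
      have hpow : τ ^ m = τ ^ (m - 1) * τ := by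
        rw [← pow_succ, Nat.sub_add_cancel (Nat.one_le_iff_ne_zero.2 hm)]
      calc r * (τ ^ m * f (r * τ)) = r * τ ^ m * f (r * τ) := by ring
        _ ≤ _ := hle
        _ = _ := by
          rw [hpow]
          field_simp
          ring
  rw [intervalIntegral.integral_const_mul] at h
  simpa [radialMean, hm] using h

theorem tendsto_radialMean (m : ℕ) {f : ℕ → ℝ → ℝ} {f₀ b : ℝ → ℝ} (hf : ∀ k, Continuous (f k))
    (hb : Continuous b) (hfb : ∀ k t, 0 ≤ t → |f k t| ≤ b t)
    (hlim : ∀ t, 0 ≤ t → Filter.Tendsto (fun k => f k t) Filter.atTop (nhds (f₀ t)))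
    {s : ℝ} (hs : 0 ≤ s) :
    Filter.Tendsto (fun k => radialMean m (f k) s) Filter.atTop (nhds (radialMean m f₀ s)) := by
  refine intervalIntegral.tendsto_integral_filter_of_dominated_convergence
    (fun τ => τ ^ m * b (s * τ)) (Filter.Eventually.of_forall fun k => ?_)
    (Filter.Eventually.of_forall fun k => Filter.Eventually.of_forall fun τ hτ => ?_)
    (Continuous.intervalIntegrable (by fun_prop) _ _)
    (Filter.Eventually.of_forall fun τ hτ => ?_)
  · have := hf k
    exact Continuous.aestronglyMeasurable (by fun_prop)
  all_goals
    rw [uIoc_of_le zero_le_one] at hτ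
    have hsτ : 0 ≤ s * τ := mul_nonneg hs hτ.1.le
  · rw [norm_mul, norm_pow, Real.norm_eq_abs, Real.norm_eq_abs, abs_of_pos hτ.1]
    exact mul_le_mul_of_nonneg_left (hfb k _ hsτ) (pow_nonneg hτ.1.le m)
  · exact (hlim _ hsτ).const_mul _

theorem tendsto_radialPotential (m : ℕ) {f : ℕ → ℝ → ℝ} {f₀ b : ℝ → ℝ}
    (hf : ∀ k, Continuous (f k)) (hb : Continuous b) (hf0 : ∀ k t, 0 ≤ t → 0 ≤ f k t)
    (hfb : ∀ k t, 0 ≤ t → f k t ≤ b t)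
    (hlim : ∀ t, 0 ≤ t → Filter.Tendsto (fun k => f k t) Filter.atTop (nhds (f₀ t)))
    (c : ℝ) {r : ℝ} (hr : 0 ≤ r) :
    Filter.Tendsto (fun k => radialPotential m (f k) c r) Filter.atTop
      (nhds (radialPotential m f₀ c r)) := by
  refine Filter.Tendsto.const_add c ?_
  refine intervalIntegral.tendsto_integral_filter_of_dominated_convergence
    (fun s => s * radialMean m b s) (Filter.Eventually.of_forall fun k => ?_)
    (Filter.Eventually.of_forall fun k => Filter.Eventually.of_forall fun s hs => ?_)
    ((continuous_id.mul (continuous_radialMean m hb)).intervalIntegrable _ _)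
    (Filter.Eventually.of_forall fun s hs => ?_)
  · exact (continuous_id.mul (continuous_radialMean m (hf k))).aestronglyMeasurable
  all_goals
    rw [uIoc_of_le hr] at hs
    have hs0 : 0 ≤ s := hs.1.le
  · rw [Real.norm_eq_abs, abs_of_nonneg (mul_nonneg hs0 (radialMean_nonneg m (hf0 k) hs0))]
    exact mul_le_mul_of_nonneg_left (radialMean_mono m (hf k) hb (hfb k) hs0) hs0
  · refine (tendsto_radialMean m hf hb (fun k t ht => ?_) hlim hs0).const_mul s
    rw [abs_of_nonneg (hf0 k t ht)]
    exact hfb k t ht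

theorem radialPotential_sub (m : ℕ) {f : ℝ → ℝ} (hf : Continuous f) (c a b : ℝ) :
    radialPotential m f c b - radialPotential m f c a = ∫ s in a..b, s * radialMean m f s := by
  have hc := continuous_id.mul (continuous_radialMean m hf)
  rw [radialPotential, radialPotential, add_sub_add_left_eq_sub]
  exact intervalIntegral.integral_interval_sub_left (hc.intervalIntegrable _ _)
    (hc.intervalIntegrable _ _)

theorem radialPotential_mono_right (m : ℕ) {f : ℝ → ℝ} (hf : Continuous f)
    (hf0 : ∀ t, 0 ≤ t → 0 ≤ f t) (c : ℝ) {a b : ℝ} (ha : 0 ≤ a) (hab : a ≤ b) :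
    radialPotential m f c a ≤ radialPotential m f c b := by
  rw [← sub_nonneg, radialPotential_sub m hf]
  refine intervalIntegral.integral_nonneg hab fun s hs => ?_
  have hs0 := ha.trans hs.1
  exact mul_nonneg hs0 (radialMean_nonneg m hf0 hs0)

theorem radialPotential_mono (m : ℕ) {f g : ℝ → ℝ} (hf : Continuous f) (hg : Continuous g)
    (hfg : ∀ t, 0 ≤ t → f t ≤ g t) (c : ℝ) {r : ℝ} (hr : 0 ≤ r) :
    radialPotential m f c r ≤ radialPotential m g c r := by
  refine add_le_add_right (intervalIntegral.integral_mono_on hr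
    ((continuous_id.mul (continuous_radialMean m hf)).intervalIntegrable _ _)
    ((continuous_id.mul (continuous_radialMean m hg)).intervalIntegrable _ _) fun s hs => ?_) c
  exact mul_le_mul_of_nonneg_left (radialMean_mono m hf hg hfg hs.1) hs.1

/-- The monotone iterates `u ↦ 1 + ∫₀ʳ s * radialMean m (q u) s ds` started at `0`. -/
noncomputable def radialIterate (m : ℕ) (q : ℝ → ℝ) : ℕ → ℝ → ℝ
  | 0 => fun _ => 0
  | k + 1 => radialPotential m (fun t => q t * radialIterate m q k t) 1

section Iterate

variable {m : ℕ} {q ψ ψ' : ℝ → ℝ}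

theorem continuous_radialIterate (hq : Continuous q) (k : ℕ) :
    Continuous (radialIterate m q k) := by
  induction k with
  | zero => exact continuous_const
  | succ k ih =>
    exact continuous_iff_continuousAt.2 fun r =>
      (hasDerivAt_radialPotential m (hq.mul ih) 1 r).continuousAt

theorem radialIterate_nonneg (hq0 : ∀ t, 0 ≤ q t) (k : ℕ) {r : ℝ} (hr : 0 ≤ r) :
    0 ≤ radialIterate m q k r := by
  induction k generalizing r with
  | zero => exact le_rfl
  | succ k ih =>
    refine add_nonneg zero_le_one (intervalIntegral.integral_nonneg hr fun s hs => ?_)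
    exact mul_nonneg hs.1 (radialMean_nonneg m (fun t ht => mul_nonneg (hq0 t) (ih ht)) hs.1)

theorem radialIterate_le_succ (hq : Continuous q) (hq0 : ∀ t, 0 ≤ q t) (k : ℕ) {r : ℝ}
    (hr : 0 ≤ r) : radialIterate m q k r ≤ radialIterate m q (k + 1) r := by
  induction k generalizing r with
  | zero => exact radialIterate_nonneg hq0 1 hr
  | succ k ih =>
    exact radialPotential_mono m (hq.mul (continuous_radialIterate hq k))
      (hq.mul (continuous_radialIterate hq (k + 1)))
      (fun t ht => mul_le_mul_of_nonneg_left (ih ht) (hq0 t)) 1 hr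

theorem radialPotential_sub_le (hq : Continuous q) (hq0 : ∀ t, 0 ≤ q t) (hψ : Continuous ψ)
    (hψ' : ∀ r, 0 < r → HasDerivAt ψ (ψ' r) r)
    (hsup : ∀ r, 0 < r → r * radialMean m (fun t => q t * ψ t) r ≤ ψ' r)
    {v : ℝ → ℝ} (hv : Continuous v) (hvψ : ∀ t, 0 ≤ t → v t ≤ ψ t) {a b : ℝ} (ha : 0 ≤ a)
    (hab : a ≤ b) :
    radialPotential m (fun t => q t * v t) 1 b - radialPotential m (fun t => q t * v t) 1 a ≤
      ψ b - ψ a := by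
  have hqv : Continuous fun t => q t * v t := hq.mul hv
  rw [radialPotential_sub m hqv]
  refine intervalIntegral.integral_le_sub_of_hasDeriv_right_of_le hab hψ.continuousOn
    (fun s hs => (hψ' s (ha.trans_lt hs.1)).hasDerivWithinAt)
    ((continuous_id.mul (continuous_radialMean m hqv)).continuousOn.integrableOn_compact
      isCompact_Icc) fun s hs => ?_
  have hs0 : 0 < s := ha.trans_lt hs.1
  exact (mul_le_mul_of_nonneg_left (radialMean_mono m hqv (hq.mul hψ)
    (fun t ht => mul_le_mul_of_nonneg_left (hvψ t ht) (hq0 t)) hs0.le) hs0.le).trans (hsup s hs0)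

theorem radialIterate_le (hq : Continuous q) (hq0 : ∀ t, 0 ≤ q t) (hψ : Continuous ψ)
    (hψ0 : ∀ t, 0 ≤ ψ t) (hψ1 : 1 ≤ ψ 0) (hψ' : ∀ r, 0 < r → HasDerivAt ψ (ψ' r) r)
    (hsup : ∀ r, 0 < r → r * radialMean m (fun t => q t * ψ t) r ≤ ψ' r)
    (k : ℕ) {r : ℝ} (hr : 0 ≤ r) : radialIterate m q k r ≤ ψ r := by
  induction k generalizing r with
  | zero => exact hψ0 r
  | succ k ih =>
    have h := radialPotential_sub_le hq hq0 hψ hψ' hsup (continuous_radialIterate hq k)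
      (fun t ht => ih ht) le_rfl hr
    have h0 : radialPotential m (fun t => q t * radialIterate m q k t) 1 0 = 1 := by
      simp [radialPotential]
    rw [radialIterate]
    linarith

/-- A supersolution `ψ` of the radial equation `u'' + (m / r) u' = q u` dominates the regular
solution with `u 0 = 1`, which is obtained by monotone iteration. -/
theorem exists_radial_solution_le (hq : Continuous q) (hq0 : ∀ t, 0 ≤ q t) (hψ : Continuous ψ)
    (hψ0 : ∀ t, 0 ≤ ψ t) (hψ1 : 1 ≤ ψ 0) (hψ' : ∀ r, 0 < r → HasDerivAt ψ (ψ' r) r)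
    (hsup : ∀ r, 0 < r → r * radialMean m (fun t => q t * ψ t) r ≤ ψ' r) :
    ∃ u : ℝ → ℝ, Continuous u ∧ ∀ r, 0 ≤ r →
      1 ≤ u r ∧ u r ≤ ψ r ∧ radialPotential m (fun t => q t * u t) 1 r = u r := by
  have hle (k : ℕ) {r : ℝ} (hr : 0 ≤ r) : radialIterate m q k r ≤ ψ r :=
    radialIterate_le hq hq0 hψ hψ0 hψ1 hψ' hsup k hr
  have hc (k : ℕ) := continuous_radialIterate (m := m) hq k
  set u : ℝ → ℝ := fun r => ⨆ k, radialIterate m q k |r| with hu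
  have hlim {r : ℝ} (hr : 0 ≤ r) :
      Filter.Tendsto (fun k => radialIterate m q k r) Filter.atTop (nhds (u r)) := by
    simp only [hu, abs_of_nonneg hr]
    refine tendsto_atTop_ciSup
      (monotone_nat_of_le_succ fun k => radialIterate_le_succ hq hq0 k hr) ⟨ψ r, ?_⟩
    rintro _ ⟨k, rfl⟩
    exact hle k hr
  have hfix {r : ℝ} (hr : 0 ≤ r) : radialPotential m (fun t => q t * u t) 1 r = u r := by
    refine tendsto_nhds_unique ?_ ((hlim hr).comp (Filter.tendsto_add_atTop_nat 1))
    exact tendsto_radialPotential m (fun k => hq.mul (hc k)) (hq.mul hψ)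
      (fun k t ht => mul_nonneg (hq0 t) (radialIterate_nonneg hq0 k ht))
      (fun k t ht => mul_le_mul_of_nonneg_left (hle k ht) (hq0 t))
      (fun t ht => (hlim ht).const_mul (q t)) 1 hr
  have hu0 {r : ℝ} (hr : 0 ≤ r) : 0 ≤ u r :=
    ge_of_tendsto' (hlim hr) fun k => radialIterate_nonneg hq0 k hr
  have hosc {a b : ℝ} (ha : 0 ≤ a) (hab : a ≤ b) : |u b - u a| ≤ |ψ b - ψ a| := by
    have ht := ((hlim (ha.trans hab)).comp (Filter.tendsto_add_atTop_nat 1)).sub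
      ((hlim ha).comp (Filter.tendsto_add_atTop_nat 1))
    have h0 : 0 ≤ u b - u a := ge_of_tendsto' ht fun k =>
      sub_nonneg.2 (radialPotential_mono_right m (hq.mul (hc k))
        (fun t ht => mul_nonneg (hq0 t) (radialIterate_nonneg hq0 k ht)) 1 ha hab)
    have h1 : u b - u a ≤ ψ b - ψ a := le_of_tendsto' ht fun k =>
      radialPotential_sub_le hq hq0 hψ hψ' hsup (hc k) (fun t ht => hle k ht) ha hab
    rwa [abs_of_nonneg h0, abs_of_nonneg (h0.trans h1)]
  refine ⟨u, continuous_iff_continuousAt.2 fun r => ?_, fun r hr => ⟨?_, ?_, hfix hr⟩⟩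
  · have hbound (x : ℝ) : ‖u x - u r‖ ≤ |ψ (|x|) - ψ (|r|)| := by
      have habs (y : ℝ) : u y = u |y| := by simp only [hu, abs_abs]
      rw [Real.norm_eq_abs, habs x, habs r]
      rcases le_total |r| |x| with h | h
      · exact hosc (abs_nonneg r) h
      · rw [abs_sub_comm, abs_sub_comm (ψ (|x|))]
        exact hosc (abs_nonneg x) h
    rw [ContinuousAt, tendsto_iff_norm_sub_tendsto_zero]
    refine squeeze_zero (fun _ => norm_nonneg _) hbound ?_
    have : Continuous fun x : ℝ => |ψ (|x|) - ψ (|r|)| := by fun_prop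
    simpa using this.tendsto r
  · rw [← hfix hr, radialPotential, le_add_iff_nonneg_right]
    refine intervalIntegral.integral_nonneg hr fun s hs => ?_
    exact mul_nonneg hs.1
      (radialMean_nonneg m (fun t ht => mul_nonneg (hq0 t) (hu0 ht)) hs.1)
  · exact le_of_tendsto' (hlim hr) fun k => hle k hr

end Iterate

/-- The logarithmic derivative of `scatteringBarrier m A` at `r ≥ 0`. -/
noncomputable def scatteringBarrierSlope (m : ℕ) (A r : ℝ) : ℝ :=
  1 - m / 2 * (1 + |r|)⁻¹ + A * (1 + |r|)⁻¹ ^ 2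

/-- The radial supersolution `(1 + r) ^ (-m / 2) * exp (r + A - A / (1 + r))`. -/
noncomputable def scatteringBarrier (m : ℕ) (A r : ℝ) : ℝ :=
  (1 + |r|) ^ (-(m : ℝ) / 2) * Real.exp (|r| + A - A * (1 + |r|)⁻¹)

theorem one_add_abs_pos (r : ℝ) : 0 < 1 + |r| := by positivity

theorem continuous_inv_one_add_abs : Continuous fun r : ℝ => (1 + |r|)⁻¹ :=
  (continuous_const.add continuous_abs).inv₀ fun r => (one_add_abs_pos r).ne'

theorem continuous_scatteringBarrierSlope (m : ℕ) (A : ℝ) :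
    Continuous (scatteringBarrierSlope m A) := by
  have := continuous_inv_one_add_abs
  unfold scatteringBarrierSlope
  fun_prop

theorem continuous_scatteringBarrier (m : ℕ) (A : ℝ) : Continuous (scatteringBarrier m A) := by
  have h1 := continuous_inv_one_add_abs
  have h2 : Continuous fun r : ℝ => (1 + |r|) ^ (-(m : ℝ) / 2) :=
    (continuous_const.add continuous_abs).rpow_const fun r => Or.inl (one_add_abs_pos r).ne'
  unfold scatteringBarrier
  fun_prop

theorem scatteringBarrier_pos (m : ℕ) (A r : ℝ) : 0 < scatteringBarrier m A r :=
  mul_pos (Real.rpow_pos_of_pos (one_add_abs_pos r) _) (Real.exp_pos _)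

theorem hasDerivAt_inv_one_add_abs {r : ℝ} (hr : 0 < r) :
    HasDerivAt (fun r : ℝ => (1 + |r|)⁻¹) (-(1 + |r|)⁻¹ ^ 2) r := by
  have h := ((hasDerivAt_abs_pos hr).const_add 1).inv (one_add_abs_pos r).ne'
  refine h.congr_deriv ?_
  rw [inv_pow, neg_div, one_div]

theorem hasDerivAt_scatteringBarrierSlope (m : ℕ) (A : ℝ) {r : ℝ} (hr : 0 < r) :
    HasDerivAt (scatteringBarrierSlope m A)
      (m / 2 * (1 + |r|)⁻¹ ^ 2 - 2 * A * (1 + |r|)⁻¹ ^ 3) r := by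
  have h := hasDerivAt_inv_one_add_abs hr
  refine (((h.const_mul ((m : ℝ) / 2)).const_sub 1).add ((h.pow 2).const_mul A)).congr_deriv ?_
  push_cast
  ring

theorem hasDerivAt_scatteringBarrier (m : ℕ) (A : ℝ) {r : ℝ} (hr : 0 < r) :
    HasDerivAt (scatteringBarrier m A)
      (scatteringBarrierSlope m A r * scatteringBarrier m A r) r := by
  have h := hasDerivAt_inv_one_add_abs hr
  have hpos := one_add_abs_pos r
  have h1 := ((hasDerivAt_abs_pos hr).const_add 1).rpow_const (p := -(m : ℝ) / 2)
    (Or.inl hpos.ne')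
  have h2 := (((hasDerivAt_abs_pos hr).add_const A).sub (h.const_mul A)).exp
  refine (h1.mul h2).congr_deriv ?_
  simp only [scatteringBarrierSlope, scatteringBarrier, Real.rpow_sub_one hpos.ne', Pi.sub_apply]
  ring

/-- The Riccati form of the supersolution inequality, in the variable `x = 1 / (1 + r)`. -/
theorem scatteringBarrier_riccati (m μ A x : ℝ) (hm : 0 ≤ m) (hA : A = (1 + m ^ 2 / 4 + μ) / 2) :
    1 + μ * x ^ 2 ≤ (m / 2 * x ^ 2 - 2 * A * x ^ 3) + (1 - m / 2 * x + A * x ^ 2) ^ 2 +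
      m * x * (1 - m / 2 * x + A * x ^ 2) := by
  have h : 0 ≤ x ^ 2 * (m / 2 + (A * x - 1) ^ 2) := by positivity
  have hμ : μ = 2 * A - 1 - m ^ 2 / 4 := by linarith
  subst hμ
  nlinarith

theorem scatteringBarrierSlope_nonneg (m : ℕ) {μ A : ℝ} (hμ : 0 < μ)
    (hA : A = (1 + (m : ℝ) ^ 2 / 4 + μ) / 2) (r : ℝ) : 0 ≤ scatteringBarrierSlope m A r := by
  unfold scatteringBarrierSlope
  generalize (1 + |r|)⁻¹ = x
  have h1 : 0 ≤ (1 - m / 4 * x) ^ 2 := sq_nonneg _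
  have h2 : 0 ≤ (A - (m : ℝ) ^ 2 / 16) * x ^ 2 := by
    apply mul_nonneg _ (sq_nonneg x)
    nlinarith [sq_nonneg (m : ℝ)]
  nlinarith

theorem scatteringBarrier_supersolution {m : ℕ} (hm : m ≠ 0) {μ β A : ℝ} (hμ : 0 < μ)
    (hβ : 2 < β) (hA : A = (1 + (m : ℝ) ^ 2 / 4 + μ) / 2)
    (hq : Continuous fun t : ℝ => 1 + μ / (1 + |t|) ^ β) {r : ℝ} (hr : 0 < r) :
    r * radialMean m (fun t => (1 + μ / (1 + |t|) ^ β) * scatteringBarrier m A t) r ≤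
      scatteringBarrierSlope m A r * scatteringBarrier m A r := by
  refine mul_radialMean_le hm (hq.mul (continuous_scatteringBarrier m A))
    ((continuous_scatteringBarrierSlope m A).mul (continuous_scatteringBarrier m A))
    (fun t ht => (hasDerivAt_scatteringBarrierSlope m A ht).mul
      (hasDerivAt_scatteringBarrier m A ht)) (fun t ht => ?_) hr
  have hs := one_add_abs_pos t
  have hpot : μ / (1 + |t|) ^ β ≤ μ * (1 + |t|)⁻¹ ^ 2 := by
    rw [div_eq_mul_inv, inv_pow, ← Real.rpow_natCast]
    refine mul_le_mul_of_nonneg_left (inv_anti₀ (by positivity) ?_) hμ.le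
    exact Real.rpow_le_rpow_of_exponent_le (by linarith [abs_nonneg t]) (by exact_mod_cast hβ.le)
  have hcoef : m * (1 + |t|)⁻¹ ≤ m / t := by
    rw [div_eq_mul_inv]
    refine mul_le_mul_of_nonneg_left (inv_anti₀ ht ?_) (Nat.cast_nonneg m)
    rw [abs_of_pos ht]
    linarith
  have hp := scatteringBarrierSlope_nonneg m hμ hA t
  have hric := scatteringBarrier_riccati m μ A (1 + |t|)⁻¹ (Nat.cast_nonneg m) hA
  have hfirst := mul_le_mul_of_nonneg_right hcoef hp
  have hψ := (scatteringBarrier_pos m A t).le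
  have hmain : 1 + μ / (1 + |t|) ^ β ≤ (m / 2 * (1 + |t|)⁻¹ ^ 2 - 2 * A * (1 + |t|)⁻¹ ^ 3) +
      scatteringBarrierSlope m A t ^ 2 + m / t * scatteringBarrierSlope m A t := by
    unfold scatteringBarrierSlope at *
    linarith
  refine (mul_le_mul_of_nonneg_right hmain hψ).trans (le_of_eq ?_)
  rw [Pi.mul_apply]
  ring

/-- **Lemma 3.2** (Yordanov–Zhang): for `n ≥ 2`, `μ > 0`, `β > 2`, the equation
`Δφ - μ(1+|x|)^{-β} φ = φ` on `ℝⁿ` admits a positive `C²` solution `φ` with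
`0 < φ(x) ≤ C (1+|x|)^{-(n-1)/2} e^{|x|}`. -/
theorem exists_positive_solution_scattering_potential
    (n : ℕ) (hn : 2 ≤ n) (μ β : ℝ) (hμ : 0 < μ) (hβ : 2 < β) :
    ∃ (φ : EuclideanSpace ℝ (Fin n) → ℝ) (C : ℝ),
      ContDiff ℝ 2 φ ∧ 0 < C ∧
      (∀ x, laplacian φ x - μ / (1 + ‖x‖) ^ β * φ x = φ x) ∧
      (∀ x, 0 < φ x ∧
        φ x ≤ C * (1 + ‖x‖) ^ (-((n : ℝ) - 1) / 2) * Real.exp ‖x‖) := by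
  obtain ⟨m, rfl⟩ : ∃ m, n = m + 1 := ⟨n - 1, by omega⟩
  have hm : m ≠ 0 := by omega
  obtain ⟨A, hA⟩ : ∃ A : ℝ, A = (1 + (m : ℝ) ^ 2 / 4 + μ) / 2 := ⟨_, rfl⟩
  have hA0 : 0 ≤ A := by
    rw [hA]
    positivity
  have hq : Continuous fun t : ℝ => 1 + μ / (1 + |t|) ^ β := by
    refine continuous_const.add (continuous_const.div ?_ fun t =>
      (Real.rpow_pos_of_pos (one_add_abs_pos t) β).ne')
    exact (continuous_const.add continuous_abs).rpow_const fun t =>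
      Or.inl (one_add_abs_pos t).ne'
  obtain ⟨u, huc, hu⟩ := exists_radial_solution_le (m := m) hq (fun t => by positivity)
    (continuous_scatteringBarrier m A) (fun t => (scatteringBarrier_pos m A t).le)
    (by simp [scatteringBarrier]) (fun r hr => hasDerivAt_scatteringBarrier m A hr)
    (fun r hr => scatteringBarrier_supersolution hm hμ hβ hA hq hr)
  have hqu : Continuous fun t : ℝ => (1 + μ / (1 + |t|) ^ β) * u t := hq.mul huc
  have hφ : (fun x : EuclideanSpace ℝ (Fin (m + 1)) => u ‖x‖) = fun x =>
      radialPotential m (fun t => (1 + μ / (1 + |t|) ^ β) * u t) 1 ‖x‖ :=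
    funext fun x => ((hu _ (norm_nonneg x)).2.2).symm
  refine ⟨fun x => u ‖x‖, Real.exp A, ?_, Real.exp_pos A, fun x => ?_, fun x => ⟨?_, ?_⟩⟩
  · rw [hφ]
    exact contDiff_radialPotential_norm m hqu 1
  · have hΔ : laplacian (fun x => u ‖x‖) x = (1 + μ / (1 + |‖x‖|) ^ β) * u ‖x‖ := by
      rw [hφ, laplacian_radialPotential_norm m hqu]
    rw [hΔ, abs_norm]
    ring
  · exact zero_lt_one.trans_le (hu _ (norm_nonneg x)).1
  · refine (hu _ (norm_nonneg x)).2.1.trans ?_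
    have hx : 0 ≤ A * (1 + ‖x‖)⁻¹ := by positivity
    rw [scatteringBarrier, abs_norm, Nat.cast_add_one, add_sub_cancel_right,
      mul_comm (Real.exp A), mul_assoc, ← Real.exp_add]
    gcongr
    linarith
end

section
/- Let n ≥ 1, μ > 0, β > 0 and set V(x) = μ/(1+|x|)^β. Let ψ : [0,1] × ℝⁿ → ℝ be continuous such that for each η ∈ [0,1] the function x ↦ ψ(η,x) is C², the functions (η,x) ↦ ∂_{x_i}ψ(η,x) and (η,x) ↦ ∂_{x_i}∂_{x_j}ψ(η,x) are continuous on [0,1] × ℝⁿ, and Δ_x ψ(η,x) − η V(x) ψ(η,x) = η² ψ(η,x) for all (η,x). For q > 0 define b_q(t,x) = ∫₀¹ e^{−ηt} ψ(η,x) η^{q−1} dη for (t,x) ∈ ℝ × ℝⁿ. Then for all q > 0 and all (t,x): ∂ₜ b_q(t,x) = −b_{q+1}(t,x), ∂ₜ² b_q(t,x) = b_{q+2}(t,x), Δ b_q(t,x) = V(x) b_{q+1}(t,x) + b_{q+2}(t,x), and consequently ∂ₜ² b_q(t,x) − Δ b_q(t,x) − V(x) ∂ₜ b_q(t,x) = 0.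 -/
open MeasureTheory Real Set

/-- The test-function family `b_q(t,x) = ∫₀¹ e^{-ηt} ψ(η,x) η^{q-1} dη`. -/
noncomputable def bFun {n : ℕ} (ψ : ℝ → EuclideanSpace ℝ (Fin n) → ℝ) (q t : ℝ)
    (x : EuclideanSpace ℝ (Fin n)) : ℝ :=
  ∫ η in Set.Ioc (0 : ℝ) 1, Real.exp (-η * t) * ψ η x * η ^ (q - 1)

/-- An integrable weight on `(0, 1]` times a continuous function on `[0, 1]` is integrable. -/
theorem integrableOn_Ioc_weight_mul {w g : ℝ → ℝ} (hw : IntegrableOn w (Ioc (0 : ℝ) 1))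
    (hg : ContinuousOn g (Icc (0 : ℝ) 1)) :
    IntegrableOn (fun η => w η * g η) (Ioc (0 : ℝ) 1) := by
  rw [← integrableOn_Icc_iff_integrableOn_Ioc] at hw ⊢
  exact hw.mul_continuousOn hg isCompact_Icc

/-- Differentiation under the integral sign, for a weighted integral over the compact parameter
interval `[0, 1]` whose integrand has a jointly continuous derivative. -/
theorem hasFDerivAt_integral_weight_mul {E : Type*} [NormedAddCommGroup E] [NormedSpace ℝ E]
    [ProperSpace E] {w : ℝ → ℝ} (hw : IntegrableOn w (Ioc (0 : ℝ) 1)) {φ : ℝ → E → ℝ}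
    {φ' : ℝ → E → E →L[ℝ] ℝ}
    (hφ : ∀ x, ContinuousOn (fun η => φ η x) (Icc (0 : ℝ) 1))
    (hφ' : ContinuousOn (fun z : ℝ × E => φ' z.1 z.2) (Icc (0 : ℝ) 1 ×ˢ univ))
    (hd : ∀ η ∈ Icc (0 : ℝ) 1, ∀ x, HasFDerivAt (φ η) (φ' η x) x) (x : E) :
    IntegrableOn (fun η => w η • φ' η x) (Ioc (0 : ℝ) 1) ∧
    HasFDerivAt (fun y => ∫ η in Ioc (0 : ℝ) 1, w η * φ η y)
      (∫ η in Ioc (0 : ℝ) 1, w η • φ' η x) x := by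
  have hslice : ContinuousOn (fun η => φ' η x) (Icc (0 : ℝ) 1) :=
    hφ'.comp (f := fun η : ℝ => (η, x)) (by fun_prop) fun η hη => ⟨hη, mem_univ _⟩
  have hint : IntegrableOn (fun η => w η • φ' η x) (Ioc (0 : ℝ) 1) := by
    rw [← integrableOn_Icc_iff_integrableOn_Ioc] at hw
    exact (hw.smul_continuousOn hslice isCompact_Icc).mono_set Ioc_subset_Icc_self
  refine ⟨hint, ?_⟩
  obtain ⟨C, hC⟩ := (isCompact_Icc.prod (isCompact_closedBall x 1)).exists_bound_of_continuousOn
    (hφ'.mono (prod_mono_right (subset_univ (Metric.closedBall x 1))))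
  refine hasFDerivAt_integral_of_dominated_of_fderiv_le (bound := fun η => ‖w η‖ * C)
    (F' := fun y η => w η • φ' η y) (Metric.ball_mem_nhds x one_pos) ?_
    (integrableOn_Ioc_weight_mul hw (hφ x)) hint.aestronglyMeasurable ?_ (hw.norm.mul_const C) ?_
  · exact .of_forall fun y => (integrableOn_Ioc_weight_mul hw (hφ y)).aestronglyMeasurable
  · refine ae_restrict_of_forall_mem measurableSet_Ioc fun η hη y hy => ?_
    rw [norm_smul]
    exact mul_le_mul_of_nonneg_left
      (hC (η, y) ⟨Ioc_subset_Icc_self hη, Metric.ball_subset_closedBall hy⟩) (norm_nonneg _)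
  · exact ae_restrict_of_forall_mem measurableSet_Ioc fun η hη y _ =>
      (hd η (Ioc_subset_Icc_self hη) y).const_mul (w η)

/-- Directional derivatives commute with weighted integrals over `[0, 1]` when the coordinate
derivatives of the integrand are jointly continuous. -/
theorem fderiv_integral_weight_mul {n : ℕ} {w : ℝ → ℝ} (hw : IntegrableOn w (Ioc (0 : ℝ) 1))
    {φ : ℝ → EuclideanSpace ℝ (Fin n) → ℝ}
    (hφ : ∀ x, ContinuousOn (fun η => φ η x) (Icc (0 : ℝ) 1))
    (hφ' : ∀ i : Fin n, ContinuousOn (fun z : ℝ × EuclideanSpace ℝ (Fin n) =>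
      fderiv ℝ (φ z.1) z.2 (EuclideanSpace.single i 1)) (Icc (0 : ℝ) 1 ×ˢ univ))
    (hd : ∀ η ∈ Icc (0 : ℝ) 1, Differentiable ℝ (φ η)) (x v : EuclideanSpace ℝ (Fin n)) :
    fderiv ℝ (fun y => ∫ η in Ioc (0 : ℝ) 1, w η * φ η y) x v =
      ∫ η in Ioc (0 : ℝ) 1, w η * fderiv ℝ (φ η) x v := by
  have hcoord : ∀ L : EuclideanSpace ℝ (Fin n) →L[ℝ] ℝ,
      L = ∑ i, L (EuclideanSpace.single i 1) • EuclideanSpace.proj (𝕜 := ℝ) i := by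
    intro L
    refine ContinuousLinearMap.coe_injective
      ((EuclideanSpace.basisFun (Fin n) ℝ).toBasis.ext fun j => ?_)
    simp
  have hcont : ContinuousOn (fun z : ℝ × EuclideanSpace ℝ (Fin n) => fderiv ℝ (φ z.1) z.2)
      (Icc (0 : ℝ) 1 ×ˢ univ) := by
    refine (continuousOn_finsetSum Finset.univ fun i _ => (hφ' i).smul
      (continuousOn_const (c := EuclideanSpace.proj (𝕜 := ℝ) i))).congr fun z _ => ?_
    exact hcoord _
  obtain ⟨hint, hder⟩ := hasFDerivAt_integral_weight_mul hw hφ hcont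
    (fun η hη y => (hd η hη y).hasFDerivAt) x
  rw [hder.fderiv, ContinuousLinearMap.integral_apply hint]
  rfl

theorem integrableOn_rpow_sub_one {q : ℝ} (hq : 0 < q) :
    IntegrableOn (fun η : ℝ => η ^ (q - 1)) (Ioc (0 : ℝ) 1) :=
  (intervalIntegral.intervalIntegrable_rpow' (a := 0) (b := 1) (by linarith)).1

theorem integrableOn_exp_mul_rpow_sub_one {q : ℝ} (hq : 0 < q) (t : ℝ) :
    IntegrableOn (fun η : ℝ => η ^ (q - 1) * exp (-η * t)) (Ioc (0 : ℝ) 1) :=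
  integrableOn_Ioc_weight_mul (integrableOn_rpow_sub_one hq) (by fun_prop)

theorem deriv_bFun {n : ℕ} {ψ : ℝ → EuclideanSpace ℝ (Fin n) → ℝ}
    {x : EuclideanSpace ℝ (Fin n)} (hψ : ContinuousOn (fun η => ψ η x) (Icc (0 : ℝ) 1))
    {q : ℝ} (hq : 0 < q) (t : ℝ) :
    deriv (fun s => bFun ψ q s x) t = -bFun ψ (q + 1) t x := by
  have hfst : ContinuousOn (fun z : ℝ × ℝ => ψ z.1 x) (Icc (0 : ℝ) 1 ×ˢ univ) :=
    hψ.comp continuousOn_fst fun z hz => hz.1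
  obtain ⟨hint, hder⟩ := hasFDerivAt_integral_weight_mul (integrableOn_rpow_sub_one hq)
    (φ := fun η s => exp (-η * s) * ψ η x)
    (φ' := fun η s => ContinuousLinearMap.toSpanSingleton ℝ (exp (-η * s) * -η * ψ η x))
    (fun s => by fun_prop)
    ((ContinuousLinearMap.toSpanSingletonCLE (𝕜 := ℝ) (E := ℝ)).continuous.comp_continuousOn
      ((by fun_prop : ContinuousOn (fun z : ℝ × ℝ => exp (-z.1 * z.2) * -z.1) _).mul hfst))
    (fun η _ s => ((((hasDerivAt_id s).const_mul (-η)).exp.mul_const (ψ η x)).congr_deriv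
      (by simp)).hasFDerivAt) t
  have hfun : (fun s => bFun ψ q s x) =
      fun s => ∫ η in Ioc (0 : ℝ) 1, η ^ (q - 1) * (exp (-η * s) * ψ η x) :=
    funext fun s => integral_congr_ae (.of_forall fun η => mul_comm _ _)
  rw [hfun, hder.hasDerivAt.deriv, ContinuousLinearMap.integral_apply hint, bFun, ← integral_neg]
  refine setIntegral_congr_fun measurableSet_Ioc fun η hη => ?_
  have : η ^ (q + 1 - 1) = η ^ (q - 1) * η := by
    rw [← rpow_add_one hη.1.ne']; ring_nf
  simp only [smul_apply, ContinuousLinearMap.toSpanSingleton_apply, this,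
    smul_eq_mul]
  ring

theorem laplacian_bFun {n : ℕ} {ψ : ℝ → EuclideanSpace ℝ (Fin n) → ℝ}
    (hψ : ∀ x, ContinuousOn (fun η => ψ η x) (Icc (0 : ℝ) 1))
    (hψC2 : ∀ η ∈ Icc (0 : ℝ) 1, ContDiff ℝ 2 (ψ η))
    (hψd1 : ∀ i : Fin n, ContinuousOn (fun z : ℝ × EuclideanSpace ℝ (Fin n) =>
      fderiv ℝ (ψ z.1) z.2 (EuclideanSpace.single i 1)) (Icc (0 : ℝ) 1 ×ˢ univ))
    (hψd2 : ∀ i j : Fin n, ContinuousOn (fun z : ℝ × EuclideanSpace ℝ (Fin n) =>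
      fderiv ℝ (fun y => fderiv ℝ (ψ z.1) y (EuclideanSpace.single j 1)) z.2
        (EuclideanSpace.single i 1)) (Icc (0 : ℝ) 1 ×ˢ univ))
    {q : ℝ} (hq : 0 < q) (t : ℝ) (x : EuclideanSpace ℝ (Fin n)) :
    laplacian (fun y => bFun ψ q t y) x =
      bFun (fun η => laplacian (ψ η)) q t x := by
  have hw := integrableOn_exp_mul_rpow_sub_one hq t
  have hslice : ∀ x : EuclideanSpace ℝ (Fin n),
      ContinuousOn (fun η : ℝ => (η, x)) (Icc (0 : ℝ) 1) := fun x => by fun_prop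
  have hmaps : ∀ x : EuclideanSpace ℝ (Fin n),
      MapsTo (fun η : ℝ => (η, x)) (Icc (0 : ℝ) 1) (Icc (0 : ℝ) 1 ×ˢ univ) :=
    fun x η hη => ⟨hη, mem_univ _⟩
  have hfun : (fun y => bFun ψ q t y) =
      fun y => ∫ η in Ioc (0 : ℝ) 1, η ^ (q - 1) * exp (-η * t) * ψ η y :=
    funext fun y => integral_congr_ae (.of_forall fun η => by ring)
  have hfirst (i : Fin n) :
      (fun y => fderiv ℝ (fun y => bFun ψ q t y) y (EuclideanSpace.single i 1)) = fun y =>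
        ∫ η in Ioc (0 : ℝ) 1, η ^ (q - 1) * exp (-η * t) *
          fderiv ℝ (ψ η) y (EuclideanSpace.single i 1) := by
    rw [hfun]
    exact funext fun y => fderiv_integral_weight_mul hw hψ hψd1
      (fun η hη => (hψC2 η hη).differentiable (by norm_num)) y _
  have hsecond (i : Fin n) := fderiv_integral_weight_mul hw
    (φ := fun η y => fderiv ℝ (ψ η) y (EuclideanSpace.single i 1))
    (fun y => (hψd1 i).comp (hslice y) (hmaps y)) (fun j => hψd2 j i)
    (fun η hη => (((hψC2 η hη).fderiv_right (m := 1) (by norm_num)).clm_apply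
      contDiff_const).differentiable (by norm_num)) x (EuclideanSpace.single i 1)
  simp only [laplacian, hfirst, hsecond]
  rw [← integral_finsetSum _ fun i _ => ?_]
  rotate_left
  · exact integrableOn_Ioc_weight_mul hw ((hψd2 i i).comp (hslice x) (hmaps x))
  refine integral_congr_ae (.of_forall fun η => ?_)
  simp only [laplacian, ← Finset.mul_sum]
  ring

/-- **Lemma 4.2 (i)**: if `ψ(η,·)` solves `Δψ - ηVψ = η²ψ` (with `V(x) = μ(1+|x|)^{-β}`)
and depends continuously, together with its first and second spatial derivatives, on
`(η,x) ∈ [0,1] × ℝⁿ`, then `b_q` satisfies `∂ₜ b_q = -b_{q+1}`, `∂ₜ² b_q = b_{q+2}`,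
`Δ b_q = V b_{q+1} + b_{q+2}`, and hence `∂ₜ² b_q - Δ b_q - V ∂ₜ b_q = 0`. -/
theorem bFun_identities
    (n : ℕ) (hn : 1 ≤ n) (μ β : ℝ) (hμ : 0 < μ) (hβ : 0 < β)
    (ψ : ℝ → EuclideanSpace ℝ (Fin n) → ℝ)
    (hψcont : ContinuousOn (fun z : ℝ × EuclideanSpace ℝ (Fin n) => ψ z.1 z.2)
      (Set.Icc (0 : ℝ) 1 ×ˢ (Set.univ : Set (EuclideanSpace ℝ (Fin n)))))
    (hψC2 : ∀ η ∈ Set.Icc (0 : ℝ) 1, ContDiff ℝ 2 (ψ η))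
    (hψd1 : ∀ i : Fin n, ContinuousOn
      (fun z : ℝ × EuclideanSpace ℝ (Fin n) =>
        fderiv ℝ (ψ z.1) z.2 (EuclideanSpace.single i 1))
      (Set.Icc (0 : ℝ) 1 ×ˢ (Set.univ : Set (EuclideanSpace ℝ (Fin n)))))
    (hψd2 : ∀ i j : Fin n, ContinuousOn
      (fun z : ℝ × EuclideanSpace ℝ (Fin n) =>
        fderiv ℝ (fun y => fderiv ℝ (ψ z.1) y (EuclideanSpace.single j 1)) z.2
          (EuclideanSpace.single i 1))
      (Set.Icc (0 : ℝ) 1 ×ˢ (Set.univ : Set (EuclideanSpace ℝ (Fin n)))))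
    (hψeq : ∀ η ∈ Set.Icc (0 : ℝ) 1, ∀ x,
      laplacian (ψ η) x - η * (μ / (1 + ‖x‖) ^ β) * ψ η x = η ^ 2 * ψ η x) :
    ∀ (q : ℝ), 0 < q → ∀ (t : ℝ) (x : EuclideanSpace ℝ (Fin n)),
      deriv (fun s => bFun ψ q s x) t = -(bFun ψ (q + 1) t x) ∧
      deriv (fun s => deriv (fun r => bFun ψ q r x) s) t = bFun ψ (q + 2) t x ∧
      laplacian (fun y => bFun ψ q t y) x
        = μ / (1 + ‖x‖) ^ β * bFun ψ (q + 1) t x + bFun ψ (q + 2) t x ∧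
      deriv (fun s => deriv (fun r => bFun ψ q r x) s) t
        - laplacian (fun y => bFun ψ q t y) x
        - μ / (1 + ‖x‖) ^ β * deriv (fun s => bFun ψ q s x) t = 0 := by
  intro q hq t x
  have hψ : ∀ x, ContinuousOn (fun η => ψ η x) (Icc (0 : ℝ) 1) := fun x =>
    hψcont.comp (f := fun η : ℝ => (η, x)) (by fun_prop) fun η hη => ⟨hη, mem_univ _⟩
  have hdt : deriv (fun s => bFun ψ q s x) t = -(bFun ψ (q + 1) t x) := deriv_bFun (hψ x) hq t
  have hdtt : deriv (fun s => deriv (fun r => bFun ψ q r x) s) t = bFun ψ (q + 2) t x := by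
    rw [funext (deriv_bFun (hψ x) hq), deriv.fun_neg, deriv_bFun (hψ x) (by linarith), neg_neg,
      add_assoc, one_add_one_eq_two]
  have hlap : laplacian (fun y => bFun ψ q t y) x
      = μ / (1 + ‖x‖) ^ β * bFun ψ (q + 1) t x + bFun ψ (q + 2) t x := by
    have hint : ∀ p : ℝ, 0 < p →
        IntegrableOn (fun η => exp (-η * t) * ψ η x * η ^ (p - 1)) (Ioc (0 : ℝ) 1) :=
      fun p hp => (integrableOn_Ioc_weight_mul (integrableOn_exp_mul_rpow_sub_one hp t)
        (hψ x)).congr (.of_forall fun η => by ring)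
    rw [laplacian_bFun hψ hψC2 hψd1 hψd2 hq, bFun, bFun, bFun, ← integral_const_mul,
      ← integral_add ((hint (q + 1) (by linarith)).const_mul _) (hint (q + 2) (by linarith))]
    refine setIntegral_congr_fun measurableSet_Ioc fun η hη => ?_
    have h1 : η ^ (q + 1 - 1) = η ^ (q - 1) * η := by
      rw [← rpow_add_one hη.1.ne']; ring_nf
    have h2 : η ^ (q + 2 - 1) = η ^ (q - 1) * η ^ 2 := by
      rw [← rpow_add_natCast hη.1.ne']; push_cast; ring_nf
    simp only [h1, h2]
    linear_combination exp (-η * t) * η ^ (q - 1) * hψeq η (Ioc_subset_Icc_self hη) x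
  refine ⟨hdt, hdtt, hlap, ?_⟩
  rw [hdt, hdtt, hlap]
  ring
end

section
/- Let n ≥ 2 and q > (n−1)/2. Define h(z) = ∫₀^1 (u(1−u))^{(n−3)/2} (1 − u z)^{−q} du for z ∈ [0,1). Then there exist constants c > 0 and C > 0 (depending on n and q) such that for all z ∈ [0,1): c (1−z)^{(n−1)/2 − q} ≤ h(z) ≤ C (1−z)^{(n−1)/2 − q}. -/
open MeasureTheory Real Set

/-- On `[1/2, 1]` the power function is bounded above and below. -/
lemma rpow_bounds_of_half_le {x : ℝ} (a : ℝ) (hx : 1 / 2 ≤ x) (hx1 : x ≤ 1) :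
    (2 : ℝ) ^ (-|a|) ≤ x ^ a ∧ x ^ a ≤ (2 : ℝ) ^ |a| := by
  have hx0 : 0 < x := by linarith
  have h2 : ((1 / 2 : ℝ)) ^ |a| = 2 ^ (-|a|) := by
    rw [one_div, inv_rpow zero_le_two, rpow_neg zero_le_two]
  have h3 : ((1 / 2 : ℝ)) ^ (-|a|) = 2 ^ |a| := by
    rw [one_div, inv_rpow zero_le_two, rpow_neg zero_le_two, inv_inv]
  constructor
  · rw [← h2]
    exact (rpow_le_rpow (by norm_num) hx (abs_nonneg a)).trans
      (rpow_le_rpow_of_exponent_ge hx0 hx1 (le_abs_self a))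
  · rw [← h3]
    exact (rpow_le_rpow_of_exponent_ge hx0 hx1 (neg_abs_le a)).trans
      (rpow_le_rpow_of_nonpos (by norm_num) hx (by simp))

lemma setIntegral_Ioc_rpow_sub_one {s d : ℝ} (hs : 0 < s) (hd : 0 ≤ d) :
    IntegrableOn (fun w : ℝ => w ^ (s - 1)) (Ioc 0 d) ∧
      ∫ w in Ioc 0 d, w ^ (s - 1) = d ^ s / s := by
  constructor
  · rw [← intervalIntegrable_iff_integrableOn_Ioc_of_le hd]
    exact intervalIntegral.intervalIntegrable_rpow' (by linarith)
  · rw [← intervalIntegral.integral_of_le hd, integral_rpow (Or.inl (by linarith))]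
    simp [hs.ne']

lemma setIntegral_Ioi_rpow_mul_max_rpow {s q d : ℝ} (hs : 0 < s) (hq : s < q) (hd : 0 < d) :
    IntegrableOn (fun w : ℝ => w ^ (s - 1) * (max d w) ^ (-q)) (Ioi 0) ∧
      ∫ w in Ioi 0, w ^ (s - 1) * (max d w) ^ (-q) = (1 / s + 1 / (q - s)) * d ^ (s - q) := by
  obtain ⟨hi, hv⟩ := setIntegral_Ioc_rpow_sub_one hs hd.le
  have e1 : EqOn (fun w : ℝ => w ^ (s - 1) * (max d w) ^ (-q))
      (fun w => w ^ (s - 1) * d ^ (-q)) (Ioc 0 d) := fun w hw => by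
    simp only [max_eq_left hw.2]
  have e2 : EqOn (fun w : ℝ => w ^ (s - 1) * (max d w) ^ (-q))
      (fun w => w ^ (s - 1 - q)) (Ioi d) := fun w hw => by
    simp only [max_eq_right (le_of_lt (mem_Ioi.1 hw))]
    rw [← rpow_add (hd.trans hw), ← sub_eq_add_neg]
  have i1 : IntegrableOn (fun w : ℝ => w ^ (s - 1) * (max d w) ^ (-q)) (Ioc 0 d) :=
    (integrableOn_congr_fun e1 measurableSet_Ioc).2 (hi.mul_const _)
  have i2 : IntegrableOn (fun w : ℝ => w ^ (s - 1) * (max d w) ^ (-q)) (Ioi d) :=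
    (integrableOn_congr_fun e2 measurableSet_Ioi).2
      (integrableOn_Ioi_rpow_of_lt (by linarith) hd)
  have key : d ^ (s - q) = d ^ s * d ^ (-q) := by rw [sub_eq_add_neg, rpow_add hd]
  rw [← Ioc_union_Ioi_eq_Ioi hd.le]
  refine ⟨i1.union i2, ?_⟩
  rw [setIntegral_union Ioc_disjoint_Ioi_same measurableSet_Ioi i1 i2,
    setIntegral_congr_fun measurableSet_Ioc e1, setIntegral_congr_fun measurableSet_Ioi e2,
    integral_mul_const, hv, integral_Ioi_rpow_of_lt (by linarith) hd,
    show s - 1 - q + 1 = s - q by ring, key, ← neg_sub q s]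
  have : q - s ≠ 0 := by linarith
  field_simp

lemma setIntegral_Ioo_zero_one_comp_one_sub (f : ℝ → ℝ) :
    ∫ u in Ioo (0 : ℝ) 1, f (1 - u) = ∫ w in Ioo (0 : ℝ) 1, f w := by
  simp only [← integral_Ioc_eq_integral_Ioo, ← intervalIntegral.integral_of_le zero_le_one]
  simp

lemma beta_kernel_le {s q z w : ℝ} (hq : 0 < q) (hz : z ∈ Ico (0 : ℝ) 1)
    (hw : w ∈ Ioo (0 : ℝ) 1) :
    ((1 - w) * w) ^ (s - 1) * (1 - (1 - w) * z) ^ (-q) ≤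
      2 ^ |s - 1| * (2 ^ q * (1 - w) ^ (s - 1) + w ^ (s - 1) * (max (1 - z) w) ^ (-q)) := by
  obtain ⟨hz0, hz1⟩ := hz
  obtain ⟨hw0, hw1⟩ := hw
  have h1w : 0 < 1 - w := by linarith
  have hm : max (1 - z) w ≤ 1 - (1 - w) * z := max_le (by nlinarith) (by nlinarith)
  have hm0 : 0 < max (1 - z) w := lt_max_of_lt_right hw0
  have hle : (1 - (1 - w) * z) ^ (-q) ≤ (max (1 - z) w) ^ (-q) :=
    rpow_le_rpow_of_nonpos hm0 hm (by linarith)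
  have p1 : 0 < (1 - w) ^ (s - 1) := rpow_pos_of_pos h1w _
  have p2 : 0 < w ^ (s - 1) := rpow_pos_of_pos hw0 _
  have p3 : 0 < (max (1 - z) w) ^ (-q) := rpow_pos_of_pos hm0 _
  have p4 : 0 < (1 - (1 - w) * z) ^ (-q) := rpow_pos_of_pos (hm0.trans_le hm) _
  have p5 : (0 : ℝ) < 2 ^ |s - 1| := by positivity
  rw [mul_rpow h1w.le hw0.le]
  rcases le_total w (1 / 2) with h | h
  · have hb := (rpow_bounds_of_half_le (s - 1) (by linarith : 1 / 2 ≤ 1 - w) (by linarith)).2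
    calc (1 - w) ^ (s - 1) * w ^ (s - 1) * (1 - (1 - w) * z) ^ (-q)
        ≤ 2 ^ |s - 1| * w ^ (s - 1) * (max (1 - z) w) ^ (-q) := by gcongr
      _ = 2 ^ |s - 1| * (w ^ (s - 1) * (max (1 - z) w) ^ (-q)) := by ring
      _ ≤ _ := by gcongr; exact le_add_of_nonneg_left (by positivity)
  · have hb := (rpow_bounds_of_half_le (s - 1) h hw1.le).2
    have hc : (1 - (1 - w) * z) ^ (-q) ≤ 2 ^ q := by
      have h' := rpow_le_rpow_of_nonpos (by norm_num)
        (h.trans ((le_max_right _ _).trans hm)) (by linarith : -q ≤ 0)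
      rwa [one_div, inv_rpow zero_le_two, rpow_neg zero_le_two, inv_inv] at h'
    calc (1 - w) ^ (s - 1) * w ^ (s - 1) * (1 - (1 - w) * z) ^ (-q)
        ≤ (1 - w) ^ (s - 1) * 2 ^ |s - 1| * 2 ^ q := by gcongr
      _ = 2 ^ |s - 1| * (2 ^ q * (1 - w) ^ (s - 1)) := by ring
      _ ≤ _ := by gcongr; exact le_add_of_nonneg_right (by positivity)

lemma le_beta_kernel {s q z w : ℝ} (hq : 0 < q) (hz : z ∈ Ico (0 : ℝ) 1)
    (hw : w ∈ Ioc 0 ((1 - z) / 2)) :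
    2 ^ (-|s - 1|) * w ^ (s - 1) * (2 * (1 - z)) ^ (-q) ≤
      ((1 - w) * w) ^ (s - 1) * (1 - (1 - w) * z) ^ (-q) := by
  obtain ⟨hz0, hz1⟩ := hz
  obtain ⟨hw0, hw1⟩ := hw
  rw [mul_rpow (by linarith) hw0.le]
  have hb := (rpow_bounds_of_half_le (s - 1) (by linarith : 1 / 2 ≤ 1 - w) (by linarith)).1
  have hpos : 0 < 1 - (1 - w) * z := by nlinarith
  have hc := rpow_le_rpow_of_nonpos hpos
    (by nlinarith : 1 - (1 - w) * z ≤ 2 * (1 - z)) (by linarith : -q ≤ 0)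
  have p1 : 0 < (2 * (1 - z)) ^ (-q) := rpow_pos_of_pos (by linarith) _
  have p2 : 0 < w ^ (s - 1) := rpow_pos_of_pos hw0 _
  have p3 : 0 < (1 - w) ^ (s - 1) := rpow_pos_of_pos (by linarith) _
  gcongr

/-- Two-sided bound for `∫₀¹ (u(1-u))^(s-1) (1-uz)^(-q) du` with real parameters `0 < s < q`. -/
theorem beta_kernel_integral_twosided {s q : ℝ} (hs : 0 < s) (hq : s < q) :
    ∃ c C : ℝ, 0 < c ∧ 0 < C ∧ ∀ z ∈ Ico (0 : ℝ) 1,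
      c * (1 - z) ^ (s - q) ≤
        (∫ u in Ioo (0 : ℝ) 1, (u * (1 - u)) ^ (s - 1) * (1 - u * z) ^ (-q)) ∧
      (∫ u in Ioo (0 : ℝ) 1, (u * (1 - u)) ^ (s - 1) * (1 - u * z) ^ (-q)) ≤
        C * (1 - z) ^ (s - q) := by
  have hq0 : 0 < q := hs.trans hq
  have hqs : 0 < q - s := sub_pos.2 hq
  set B : ℝ := ∫ w in Ioo (0 : ℝ) 1, (1 - w) ^ (s - 1) with hB
  have hB0 : 0 ≤ B := setIntegral_nonneg measurableSet_Ioo fun w hw =>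
    rpow_nonneg (by linarith [hw.2]) _
  have iB : IntegrableOn (fun w : ℝ => (1 - w) ^ (s - 1)) (Ioo 0 1) := by
    rw [← intervalIntegrable_iff_integrableOn_Ioo_of_le zero_le_one]
    simpa using ((intervalIntegral.intervalIntegrable_rpow' (a := 0) (b := 1)
      (by linarith : -1 < s - 1)).comp_sub_left 1).symm
  refine ⟨2 ^ (-|s - 1|) * (2 ^ (-q) * (1 / 2) ^ s / s),
    2 ^ |s - 1| * (2 ^ q * B + (1 / s + 1 / (q - s))), by positivity, by positivity,
    fun z hz => ?_⟩
  have hd : 0 < 1 - z := sub_pos.2 hz.2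
  have hrefl : (∫ u in Ioo (0 : ℝ) 1, (u * (1 - u)) ^ (s - 1) * (1 - u * z) ^ (-q)) =
      ∫ w in Ioo (0 : ℝ) 1, ((1 - w) * w) ^ (s - 1) * (1 - (1 - w) * z) ^ (-q) := by
    rw [← setIntegral_Ioo_zero_one_comp_one_sub]
    simp
  rw [hrefl]
  obtain ⟨iM, vM⟩ := setIntegral_Ioi_rpow_mul_max_rpow hs hq hd
  have iM' := iM.mono_set (Ioo_subset_Ioi_self : Ioo (0 : ℝ) 1 ⊆ Ioi 0)
  have iG := ((iB.const_mul (2 ^ q)).add iM').const_mul (2 ^ |s - 1|)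
  have hF0 : ∀ w ∈ Ioo (0 : ℝ) 1,
      0 ≤ ((1 - w) * w) ^ (s - 1) * (1 - (1 - w) * z) ^ (-q) := fun w hw =>
    mul_nonneg (rpow_nonneg (mul_nonneg (by linarith [hw.2]) hw.1.le) _)
      (rpow_nonneg (by nlinarith [hw.1, hw.2, hz.1, hz.2]) _)
  have iF : IntegrableOn
      (fun w : ℝ => ((1 - w) * w) ^ (s - 1) * (1 - (1 - w) * z) ^ (-q)) (Ioo 0 1) := by
    refine Integrable.mono' iG (Measurable.aestronglyMeasurable (by fun_prop)) ?_
    filter_upwards [ae_restrict_mem measurableSet_Ioo] with w hw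
    rw [norm_of_nonneg (hF0 w hw)]
    exact beta_kernel_le hq0 hz hw
  constructor
  · have hsub : Ioc 0 ((1 - z) / 2) ⊆ Ioo (0 : ℝ) 1 := fun w hw =>
      ⟨hw.1, by linarith [hw.2, hz.1]⟩
    obtain ⟨iL, vL⟩ := setIntegral_Ioc_rpow_sub_one hs (half_pos hd).le
    calc _ = ∫ w in Ioc 0 ((1 - z) / 2),
          2 ^ (-|s - 1|) * w ^ (s - 1) * (2 * (1 - z)) ^ (-q) := by
          rw [integral_mul_const, integral_const_mul, vL, mul_rpow zero_le_two hd.le,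
            show (1 - z) / 2 = (1 / 2) * (1 - z) by ring, mul_rpow (by norm_num) hd.le,
            sub_eq_add_neg s q, rpow_add hd]
          ring
      _ ≤ ∫ w in Ioc 0 ((1 - z) / 2),
          ((1 - w) * w) ^ (s - 1) * (1 - (1 - w) * z) ^ (-q) :=
          setIntegral_mono_on ((iL.const_mul _).mul_const _) (iF.mono_set hsub)
            measurableSet_Ioc fun w hw => le_beta_kernel hq0 hz hw
      _ ≤ _ := setIntegral_mono_set iF
          ((ae_restrict_iff' measurableSet_Ioo).2 (.of_forall hF0)) hsub.eventuallyLE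
  · have hM : ∫ w in Ioo (0 : ℝ) 1, w ^ (s - 1) * (max (1 - z) w) ^ (-q) ≤
        (1 / s + 1 / (q - s)) * (1 - z) ^ (s - q) := by
      rw [← vM]
      refine setIntegral_mono_set iM ?_ (Ioo_subset_Ioi_self : Ioo (0 : ℝ) 1 ⊆ _).eventuallyLE
      filter_upwards [ae_restrict_mem measurableSet_Ioi] with w hw
      exact mul_nonneg (rpow_nonneg (le_of_lt hw) _) (rpow_nonneg (le_max_of_le_left hd.le) _)
    have h1 : 1 ≤ (1 - z) ^ (s - q) :=
      one_le_rpow_of_pos_of_le_one_of_nonpos hd (by linarith [hz.1]) (by linarith)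
    calc _ ≤ ∫ w in Ioo (0 : ℝ) 1, 2 ^ |s - 1| *
          (2 ^ q * (1 - w) ^ (s - 1) + w ^ (s - 1) * (max (1 - z) w) ^ (-q)) :=
          setIntegral_mono_on iF iG measurableSet_Ioo fun w hw => beta_kernel_le hq0 hz hw
      _ = 2 ^ |s - 1| * (2 ^ q * B +
          ∫ w in Ioo (0 : ℝ) 1, w ^ (s - 1) * (max (1 - z) w) ^ (-q)) := by
          rw [integral_const_mul, integral_add (iB.const_mul _) iM', integral_const_mul]
      _ ≤ 2 ^ |s - 1| * (2 ^ q * B * (1 - z) ^ (s - q) +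
          (1 / s + 1 / (q - s)) * (1 - z) ^ (s - q)) := by
          refine mul_le_mul_of_nonneg_left (add_le_add ?_ hM) (by positivity)
          exact le_mul_of_one_le_right (by positivity) h1
      _ = _ := by ring

/-- For `n ≥ 2` and `q > (n-1)/2`, the function
`h(z) = ∫₀¹ (u(1-u))^{(n-3)/2} (1-uz)^{-q} du` blows up as `z → 1⁻` at the precise
rate `(1-z)^{(n-1)/2-q}`: there are `c, C > 0` with
`c (1-z)^{(n-1)/2-q} ≤ h(z) ≤ C (1-z)^{(n-1)/2-q}` for all `z ∈ [0,1)`. -/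
theorem kernel_h_twosided_supercritical
    (n : ℕ) (hn : 2 ≤ n) (q : ℝ) (hq : ((n : ℝ) - 1) / 2 < q) :
    ∃ c C : ℝ, 0 < c ∧ 0 < C ∧
      ∀ z ∈ Set.Ico (0 : ℝ) 1,
        c * (1 - z) ^ (((n : ℝ) - 1) / 2 - q) ≤
          (∫ u in Set.Ioo (0 : ℝ) 1,
            (u * (1 - u)) ^ (((n : ℝ) - 3) / 2) * (1 - u * z) ^ (-q)) ∧
        (∫ u in Set.Ioo (0 : ℝ) 1,
            (u * (1 - u)) ^ (((n : ℝ) - 3) / 2) * (1 - u * z) ^ (-q)) ≤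
          C * (1 - z) ^ (((n : ℝ) - 1) / 2 - q) := by
  have hs : 0 < ((n : ℝ) - 1) / 2 := by
    have : (2 : ℝ) ≤ n := by exact_mod_cast hn
    linarith
  rw [show ((n : ℝ) - 3) / 2 = ((n : ℝ) - 1) / 2 - 1 by ring]
  exact beta_kernel_integral_twosided hs hq
end

section
/- Let 2 < t₀ < T, let φ : [t₀, T) → ℝ be a nonnegative C¹ function, and let δ > 0, K₁ > 0, K₂ > 0 and p₁ > 1, p₂ > 1 with p₂ < p₁ + 1. Assume that for all t ∈ (t₀, T): δ ≤ K₁ t φ'(t) and φ(t)^{p₁} ≤ K₂ t (log t)^{p₂−1} φ'(t). Then there exist positive constants δ₀ and K₃, depending only on t₀, K₁, K₂, p₁, p₂ (and not on δ), such that if 0 < δ < δ₀ then T ≤ exp(K₃ δ^{−(p₁−1)/(p₁−p₂+1)}). -/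
open MeasureTheory Real Set

/-- Quantitative blow-up bound: a positive function with `c * u ^ p ≤ u'` and `p > 1` on `[a, b]`
satisfies `(p - 1) * c * (b - a) ≤ u a ^ (1 - p)`. -/
theorem sub_le_rpow_of_mul_rpow_le_deriv {u : ℝ → ℝ} {a b c p : ℝ} (hp : 1 < p) (hab : a ≤ b)
    (hcont : ContinuousOn u (Icc a b)) (hdiff : ∀ s ∈ Ioo a b, DifferentiableAt ℝ u s)
    (hpos : ∀ s ∈ Icc a b, 0 < u s) (hderiv : ∀ s ∈ Ioo a b, c * u s ^ p ≤ deriv u s) :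
    (p - 1) * c * (b - a) ≤ u a ^ (1 - p) := by
  have hd : ∀ s ∈ Ioo a b, HasDerivAt (fun s => -(u s ^ (1 - p)))
      (-(deriv u s * (1 - p) * u s ^ (1 - p - 1))) s := fun s hs =>
    ((hdiff s hs).hasDerivAt.rpow_const (Or.inl (hpos s (Ioo_subset_Icc_self hs)).ne')).neg
  have key := (convex_Icc a b).mul_sub_le_image_sub_of_le_deriv (C := (p - 1) * c)
    (f := fun s => -(u s ^ (1 - p)))
    (hcont.rpow_const fun s hs => Or.inl (hpos s hs).ne').neg
    (by
      rw [interior_Icc]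
      exact fun s hs => (hd s hs).differentiableAt.differentiableWithinAt)
    (by
      rw [interior_Icc]
      intro s hs
      rw [(hd s hs).deriv]
      have hus := hpos s (Ioo_subset_Icc_self hs)
      have h1 : u s ^ p * u s ^ (1 - p - 1) = 1 := by
        rw [← rpow_add hus]
        simp
      have h2 : c ≤ deriv u s * u s ^ (1 - p - 1) := by
        calc c = c * u s ^ p * u s ^ (1 - p - 1) := by rw [mul_assoc, h1, mul_one]
          _ ≤ _ := mul_le_mul_of_nonneg_right (hderiv s hs) (rpow_nonneg hus.le _)
      nlinarith)
    a (left_mem_Icc.2 hab) b (right_mem_Icc.2 hab) hab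
  have := rpow_nonneg (hpos b (right_mem_Icc.2 hab)).le (1 - p)
  linarith

/-- In logarithmic time: if `ψ' ≥ m` and `ψ ^ p₁ ≤ K₂ s ^ (p₂ - 1) ψ'` on `(s₀, 2 x)` with
`2 s₀ ≤ x`, then `x` is bounded in terms of `m`. -/
theorem lifespan_bound_log_time {ψ : ℝ → ℝ} {s₀ x m K₂ p₁ p₂ : ℝ} (hs₀ : 0 < s₀)
    (hx : 2 * s₀ ≤ x) (hm : 0 < m) (hK₂ : 0 < K₂) (hp₁ : 1 < p₁) (hp₂ : 1 < p₂)
    (hcont : ContinuousOn ψ (Icc s₀ (2 * x)))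
    (hdiff : ∀ s ∈ Ioo s₀ (2 * x), DifferentiableAt ℝ ψ s) (hnonneg : 0 ≤ ψ s₀)
    (hlin : ∀ s ∈ Ioo s₀ (2 * x), m ≤ deriv ψ s)
    (hpow : ∀ s ∈ Ioo s₀ (2 * x), ψ s ^ p₁ ≤ K₂ * s ^ (p₂ - 1) * deriv ψ s) :
    (p₁ - 1) / (K₂ * 2 ^ (p₂ - 1)) * (m / 2) ^ (p₁ - 1) * x ^ (p₁ - p₂ + 1) ≤ 1 := by
  have hx0 : 0 < x := by linarith
  have hgrow : ∀ s ∈ Icc x (2 * x), m / 2 * x ≤ ψ s := by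
    intro s hs
    have h := (convex_Icc s₀ (2 * x)).mul_sub_le_image_sub_of_le_deriv (C := m) hcont
      (by
        rw [interior_Icc]
        exact fun s hs => (hdiff s hs).differentiableWithinAt)
      (by rwa [interior_Icc])
      s₀ ⟨le_rfl, by linarith⟩ s ⟨by linarith [hs.1], hs.2⟩ (by linarith [hs.1])
    nlinarith [hs.1]
  have hmx : 0 < m / 2 * x := by positivity
  have hsub : Icc x (2 * x) ⊆ Icc s₀ (2 * x) := Icc_subset_Icc_left (by linarith)
  have hsub' : Ioo x (2 * x) ⊆ Ioo s₀ (2 * x) := Ioo_subset_Ioo_left (by linarith)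
  have hblow := sub_le_rpow_of_mul_rpow_le_deriv (c := 1 / (K₂ * (2 * x) ^ (p₂ - 1))) hp₁
    (by linarith : x ≤ 2 * x) (hcont.mono hsub) (fun s hs => hdiff s (hsub' hs))
    (fun s hs => hmx.trans_le (hgrow s hs))
    (by
      intro s hs
      rw [one_div_mul_eq_div, div_le_iff₀ (by positivity)]
      have hs0 : 0 < s := hx0.trans hs.1
      have hd := hm.trans_le (hlin s (hsub' hs))
      calc ψ s ^ p₁ ≤ K₂ * s ^ (p₂ - 1) * deriv ψ s := hpow s (hsub' hs)
        _ ≤ K₂ * (2 * x) ^ (p₂ - 1) * deriv ψ s := by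
          gcongr
          exact hs.2.le
        _ = _ := mul_comm _ _)
  have hle : ψ x ^ (1 - p₁) ≤ (m / 2 * x) ^ (1 - p₁) :=
    rpow_le_rpow_of_nonpos hmx (hgrow x ⟨le_rfl, by linarith⟩) (by linarith)
  have hinv : (m / 2 * x) ^ (1 - p₁) * (m / 2 * x) ^ (p₁ - 1) = 1 := by
    rw [← rpow_add hmx]
    simp
  have hxe : x ^ (p₁ - p₂ + 1) = x ^ (p₁ - 1) * x / x ^ (p₂ - 1) := by
    rw [show p₁ - p₂ + 1 = (p₁ - 1) + 1 - (p₂ - 1) by ring, rpow_sub hx0, rpow_add hx0, rpow_one]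
  calc (p₁ - 1) / (K₂ * 2 ^ (p₂ - 1)) * (m / 2) ^ (p₁ - 1) * x ^ (p₁ - p₂ + 1)
      = (p₁ - 1) * (1 / (K₂ * (2 * x) ^ (p₂ - 1))) * (2 * x - x) * (m / 2 * x) ^ (p₁ - 1) := by
        rw [hxe, mul_rpow (by norm_num) hx0.le, mul_rpow (by positivity) hx0.le]
        field_simp
        ring
    _ ≤ (m / 2 * x) ^ (1 - p₁) * (m / 2 * x) ^ (p₁ - 1) :=
        mul_le_mul_of_nonneg_right (hblow.trans hle) (by positivity)
    _ = 1 := hinv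

/-- **Lemma 4.3** (Ikeda–Sobajima–Wakasa ODE lemma): if a nonnegative `C¹` function
`φ` on `[t₀, T)` (with `t₀ > 2`) satisfies `δ ≤ K₁ t φ'(t)` and
`φ(t)^{p₁} ≤ K₂ t (log t)^{p₂-1} φ'(t)` on `(t₀,T)` with `p₁, p₂ > 1`, `p₂ < p₁ + 1`,
then `T ≤ exp(K₃ δ^{-(p₁-1)/(p₁-p₂+1)})` for all small `δ`, with `δ₀, K₃` independent
of `δ`. -/
theorem ode_lemma_exponential_lifespan
    (t₀ K₁ K₂ p₁ p₂ : ℝ) (ht₀ : 2 < t₀)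
    (hK₁ : 0 < K₁) (hK₂ : 0 < K₂) (hp₁ : 1 < p₁) (hp₂ : 1 < p₂) (hpp : p₂ < p₁ + 1) :
    ∃ δ₀ K₃ : ℝ, 0 < δ₀ ∧ 0 < K₃ ∧
      ∀ (T δ : ℝ) (φ : ℝ → ℝ),
        t₀ < T → 0 < δ → δ < δ₀ →
        ContDiffOn ℝ 1 φ (Set.Ico t₀ T) →
        (∀ t ∈ Set.Ico t₀ T, 0 ≤ φ t) →
        (∀ t ∈ Set.Ioo t₀ T, δ ≤ K₁ * t * deriv φ t) →
        (∀ t ∈ Set.Ioo t₀ T, φ t ^ p₁ ≤ K₂ * t * (Real.log t) ^ (p₂ - 1) * deriv φ t) →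
        T ≤ Real.exp (K₃ * δ ^ (-((p₁ - 1) / (p₁ - p₂ + 1)))) := by
  have hs₀ : 0 < log t₀ := log_pos (by linarith)
  have hq : 0 < p₁ - p₂ + 1 := by linarith
  have hB : 0 < (p₁ - 1) / (K₂ * 2 ^ (p₂ - 1)) * (1 / K₁ / 2) ^ (p₁ - 1) := by
    have : 0 < p₁ - 1 := by linarith
    positivity
  set B := (p₁ - 1) / (K₂ * 2 ^ (p₂ - 1)) * (1 / K₁ / 2) ^ (p₁ - 1)
  obtain ⟨A, hA1, hA2⟩ := (((tendsto_rpow_atTop hq).eventually_gt_atTop (1 / B)).and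
    (Filter.eventually_ge_atTop (2 * log t₀))).exists
  have hA : 0 < A := by linarith
  refine ⟨1, 2 * A, one_pos, by positivity, ?_⟩
  intro T δ φ hT hδ hδ1 hφ hφ0 hlin hpow
  set α := (p₁ - 1) / (p₁ - p₂ + 1) with hα
  have hα0 : 0 < α := div_pos (by linarith) hq
  by_contra! hlt
  have hδα : 1 ≤ δ ^ (-α) := one_le_rpow_of_pos_of_le_one_of_nonpos hδ hδ1.le (by linarith)
  have ht₀' : 0 < t₀ := by linarith
  have hexp : ∀ {s}, s ∈ Icc (log t₀) (2 * (A * δ ^ (-α))) → exp s ∈ Ico t₀ T := fun {s} hs =>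
    ⟨(log_le_iff_le_exp ht₀').1 hs.1, lt_of_le_of_lt (exp_le_exp.2 (hs.2.trans_eq (by ring))) hlt⟩
  have hexp' : ∀ {s}, s ∈ Ioo (log t₀) (2 * (A * δ ^ (-α))) → exp s ∈ Ioo t₀ T := fun {s} hs =>
    ⟨(log_lt_iff_lt_exp ht₀').1 hs.1, (hexp (Ioo_subset_Icc_self hs)).2⟩
  have hd : ∀ s ∈ Ioo (log t₀) (2 * (A * δ ^ (-α))),
      HasDerivAt (fun s => φ (exp s)) (deriv φ (exp s) * exp s) s := by
    intro s hs
    have hs' := hexp' hs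
    have hdiff : DifferentiableAt ℝ φ (exp s) :=
      ((hφ.differentiableOn one_ne_zero).mono Ioo_subset_Ico_self).differentiableAt
        (Ioo_mem_nhds hs'.1 hs'.2)
    exact hdiff.hasDerivAt.comp s (Real.hasDerivAt_exp s)
  have hmain := lifespan_bound_log_time (ψ := fun s => φ (exp s)) (x := A * δ ^ (-α))
    (m := δ * (1 / K₁)) hs₀ (by nlinarith) (by positivity) hK₂ hp₁ hp₂
    (hφ.continuousOn.comp continuous_exp.continuousOn fun s hs => hexp hs)
    (fun s hs => (hd s hs).differentiableAt)
    (hφ0 _ (by rw [exp_log ht₀']; exact ⟨le_rfl, hT⟩))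
    (by
      intro s hs
      rw [(hd s hs).deriv, mul_one_div, div_le_iff₀ hK₁]
      linarith [hlin _ (hexp' hs)])
    (by
      intro s hs
      rw [(hd s hs).deriv]
      have := hpow _ (hexp' hs)
      rw [log_exp] at this
      linarith)
  have hcancel : δ ^ (p₁ - 1) * (δ ^ (-α)) ^ (p₁ - p₂ + 1) = 1 := by
    rw [← rpow_mul hδ.le, ← rpow_add hδ, neg_mul, hα, div_mul_cancel₀ _ hq.ne']
    simp
  have heq : (p₁ - 1) / (K₂ * 2 ^ (p₂ - 1)) * (δ * (1 / K₁) / 2) ^ (p₁ - 1) *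
      (A * δ ^ (-α)) ^ (p₁ - p₂ + 1) = B * A ^ (p₁ - p₂ + 1) := by
    rw [mul_div_assoc, mul_rpow hδ.le (by positivity), mul_rpow hA.le (by positivity)]
    linear_combination B * A ^ (p₁ - p₂ + 1) * hcancel
  rw [heq] at hmain
  rw [div_lt_iff₀ hB] at hA1
  linarith
end

section
/- Let p > 1, a > 0, δ > 0 and T > 1, and let Y : [1, T) → ℝ be a C¹ function with Y(M) ≥ 0 for all M, satisfying Y'(M) ≥ M^{a−1} (δ + Y(M))^p for all M ∈ (1, T). Then T ≤ (1 + (a/(p−1)) δ^{−(p−1)})^{1/a}; in particular there is a constant C = C(a,p) > 0 such that T ≤ C δ^{−(p−1)/a} whenever 0 < δ ≤ 1. -/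
open MeasureTheory Real Set

/-- Integrated form of the differential inequality `Y' ≥ M^{a-1} (δ + Y)^p`. -/
theorem rpow_le_of_rpow_mul_rpow_le_deriv {p a δ T : ℝ} {Y : ℝ → ℝ} (hp : 1 < p) (ha : 0 < a)
    (hδ : 0 < δ) (hY : ContDiffOn ℝ 1 Y (Ico 1 T)) (hY0 : ∀ M ∈ Ico 1 T, 0 ≤ Y M)
    (hode : ∀ M ∈ Ioo 1 T, M ^ (a - 1) * (δ + Y M) ^ p ≤ deriv Y M) {M : ℝ}
    (hM : M ∈ Ico 1 T) : M ^ a ≤ 1 + a / (p - 1) * δ ^ (-(p - 1)) := by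
  have hp1 : 0 < p - 1 := sub_pos.2 hp
  set G : ℝ → ℝ := fun x ↦ -(a / (p - 1)) * (δ + Y x) ^ (-(p - 1)) - x ^ a with hG
  have hderiv : ∀ x ∈ Ioo 1 T, HasDerivAt G
      (a * ((δ + Y x) ^ (-p) * deriv Y x - x ^ (a - 1))) x := by
    intro x hx
    have hpos : 0 < δ + Y x := add_pos_of_pos_of_nonneg hδ (hY0 x (Ioo_subset_Ico_self hx))
    have hYx : HasDerivAt Y (deriv Y x) x :=
      ((hY.differentiableOn one_ne_zero).differentiableAt (Ico_mem_nhds hx.1 hx.2)).hasDerivAt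
    have h := (((hYx.const_add δ).rpow_const (p := -(p - 1)) (Or.inl hpos.ne')).const_mul
      (-(a / (p - 1)))).sub
      (Real.hasDerivAt_rpow_const (p := a) (Or.inl (zero_lt_one.trans hx.1).ne'))
    refine h.congr_deriv ?_
    rw [show -(p - 1) - 1 = -p by ring]
    field_simp
  have hmono : MonotoneOn G (Ico 1 T) := by
    refine monotoneOn_of_deriv_nonneg (convex_Ico 1 T) ?_ ?_ ?_
    · refine (continuousOn_const.mul ?_).sub ?_
      · exact (continuousOn_const.add hY.continuousOn).rpow_const
          fun x hx ↦ Or.inl (add_pos_of_pos_of_nonneg hδ (hY0 x hx)).ne'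
      · exact continuousOn_id.rpow_const fun x _ ↦ Or.inr ha.le
    · rw [interior_Ico]
      exact fun x hx ↦ (hderiv x hx).differentiableAt.differentiableWithinAt
    · rw [interior_Ico]
      intro x hx
      have hpos : 0 < δ + Y x := add_pos_of_pos_of_nonneg hδ (hY0 x (Ioo_subset_Ico_self hx))
      rw [(hderiv x hx).deriv]
      refine mul_nonneg ha.le (sub_nonneg.2 ?_)
      rw [rpow_neg hpos.le, inv_mul_eq_div, le_div_iff₀ (rpow_pos_of_pos hpos p)]
      exact hode x hx
  have h1 : (1 : ℝ) ∈ Ico 1 T := ⟨le_rfl, hM.1.trans_lt hM.2⟩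
  have hle := hmono h1 hM hM.1
  simp only [hG, one_rpow] at hle
  have hK : 0 < a / (p - 1) := div_pos ha hp1
  have hM0 : 0 ≤ a / (p - 1) * (δ + Y M) ^ (-(p - 1)) :=
    mul_nonneg hK.le (rpow_nonneg (add_nonneg hδ.le (hY0 M hM)) _)
  have hδ1 : a / (p - 1) * (δ + Y 1) ^ (-(p - 1)) ≤ a / (p - 1) * δ ^ (-(p - 1)) :=
    mul_le_mul_of_nonneg_left (rpow_le_rpow_of_nonpos hδ
      (le_add_of_nonneg_right (hY0 1 h1)) (neg_nonpos.2 hp1.le)) hK.le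
  linarith

/-- ODE lemma with polynomial lifespan bound: if `Y ≥ 0` is `C¹` on `[1,T)` and
`Y'(M) ≥ M^{a-1} (δ + Y(M))^p` on `(1,T)`, then
`T ≤ (1 + (a/(p-1)) δ^{-(p-1)})^{1/a}`; in particular there is `C = C(a,p) > 0`
with `T ≤ C δ^{-(p-1)/a}` whenever `0 < δ ≤ 1`. -/
theorem ode_lemma_polynomial_lifespan (p a : ℝ) (hp : 1 < p) (ha : 0 < a) :
    (∀ (δ T : ℝ) (Y : ℝ → ℝ),
        0 < δ → 1 < T →
        ContDiffOn ℝ 1 Y (Set.Ico (1 : ℝ) T) →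
        (∀ M ∈ Set.Ico (1 : ℝ) T, 0 ≤ Y M) →
        (∀ M ∈ Set.Ioo (1 : ℝ) T, M ^ (a - 1) * (δ + Y M) ^ p ≤ deriv Y M) →
        T ≤ (1 + a / (p - 1) * δ ^ (-(p - 1))) ^ (1 / a)) ∧
    ∃ C : ℝ, 0 < C ∧
      ∀ (δ T : ℝ) (Y : ℝ → ℝ),
        0 < δ → δ ≤ 1 → 1 < T →
        ContDiffOn ℝ 1 Y (Set.Ico (1 : ℝ) T) →
        (∀ M ∈ Set.Ico (1 : ℝ) T, 0 ≤ Y M) →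
        (∀ M ∈ Set.Ioo (1 : ℝ) T, M ^ (a - 1) * (δ + Y M) ^ p ≤ deriv Y M) →
        T ≤ C * δ ^ (-((p - 1) / a)) := by
  have hp1 : 0 < p - 1 := sub_pos.2 hp
  have hK : 0 < a / (p - 1) := div_pos ha hp1
  have lifespan : ∀ (δ T : ℝ) (Y : ℝ → ℝ), 0 < δ → 1 < T → ContDiffOn ℝ 1 Y (Ico 1 T) →
      (∀ M ∈ Ico 1 T, 0 ≤ Y M) →
      (∀ M ∈ Ioo 1 T, M ^ (a - 1) * (δ + Y M) ^ p ≤ deriv Y M) →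
      T ≤ (1 + a / (p - 1) * δ ^ (-(p - 1))) ^ (1 / a) := by
    intro δ T Y hδ hT hY hY0 hode
    refine le_of_forall_lt_imp_le_of_dense fun M hMT ↦ ?_
    have hmem : max 1 M ∈ Ico 1 T := ⟨le_max_left _ _, max_lt hT hMT⟩
    have hmax : 0 ≤ max 1 M := zero_le_one.trans hmem.1
    refine (le_max_right 1 M).trans ?_
    rw [one_div, le_rpow_inv_iff_of_pos hmax (by positivity) ha]
    exact rpow_le_of_rpow_mul_rpow_le_deriv hp ha hδ hY hY0 hode hmem
  refine ⟨lifespan, (1 + a / (p - 1)) ^ (1 / a), by positivity, ?_⟩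
  intro δ T Y hδ hδ1 hT hY hY0 hode
  have hone : 1 ≤ δ ^ (-(p - 1)) :=
    one_le_rpow_of_pos_of_le_one_of_nonpos hδ hδ1 (neg_nonpos.2 hp1.le)
  calc T ≤ (1 + a / (p - 1) * δ ^ (-(p - 1))) ^ (1 / a) := lifespan δ T Y hδ hT hY hY0 hode
    _ ≤ ((1 + a / (p - 1)) * δ ^ (-(p - 1))) ^ (1 / a) :=
      rpow_le_rpow (by positivity) (by linarith) (by positivity)
    _ = (1 + a / (p - 1)) ^ (1 / a) * δ ^ (-((p - 1) / a)) := by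
      rw [mul_rpow (by positivity) (by positivity), ← rpow_mul hδ.le]
      congr 2
      ring
end

section
/- Let p > 1, δ > 0 and T > 1, and let Y : [1, T) → ℝ be a C¹ function with Y(M) ≥ 0 for all M, satisfying Y'(M) ≥ M^{−1} (δ + Y(M))^p for all M ∈ (1, T). Then T ≤ exp(δ^{−(p−1)}/(p−1)). -/
open MeasureTheory Real Set

/-- ODE lemma with exponential lifespan bound: if `Y ≥ 0` is `C¹` on `[1,T)` and
`Y'(M) ≥ M⁻¹ (δ + Y(M))^p` on `(1,T)` with `p > 1`, then
`T ≤ exp(δ^{-(p-1)}/(p-1))`. -/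
theorem ode_lemma_exp_lifespan (p δ T : ℝ) (hp : 1 < p) (hδ : 0 < δ) (hT : 1 < T)
    (Y : ℝ → ℝ)
    (hY : ContDiffOn ℝ 1 Y (Set.Ico (1 : ℝ) T))
    (hY0 : ∀ M ∈ Set.Ico (1 : ℝ) T, 0 ≤ Y M)
    (hY' : ∀ M ∈ Set.Ioo (1 : ℝ) T, M⁻¹ * (δ + Y M) ^ p ≤ deriv Y M) :
    T ≤ Real.exp (δ ^ (-(p - 1)) / (p - 1)) := by
  have hp' : 0 < p - 1 := sub_pos.2 hp
  have pos : ∀ M ∈ Ico (1 : ℝ) T, 0 < δ + Y M := fun M hM => by linarith [hY0 M hM]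
  have hderiv : ∀ M ∈ Ioo (1 : ℝ) T,
      HasDerivAt (fun x => Real.log x + (δ + Y x) ^ (-(p - 1)) / (p - 1))
        (M⁻¹ + (deriv Y M * (-(p - 1)) * (δ + Y M) ^ (-(p - 1) - 1)) / (p - 1)) M := by
    intro M hM
    have hYM : HasDerivAt Y (deriv Y M) M :=
      ((hY.differentiableOn one_ne_zero).differentiableAt (Ico_mem_nhds hM.1 hM.2)).hasDerivAt
    exact (Real.hasDerivAt_log (by linarith [hM.1])).add
      (((hYM.const_add δ).rpow_const (Or.inl (pos M ⟨hM.1.le, hM.2⟩).ne')).div_const _)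
  have hanti : AntitoneOn (fun x => Real.log x + (δ + Y x) ^ (-(p - 1)) / (p - 1))
      (Ico (1 : ℝ) T) := by
    apply antitoneOn_of_deriv_nonpos (convex_Ico 1 T)
    · refine ContinuousOn.add
        (Real.continuousOn_log.mono fun x hx => (zero_lt_one.trans_le hx.1).ne') ?_
      exact ((continuousOn_const.add hY.continuousOn).rpow_const
        fun x hx => Or.inl (pos x hx).ne').div_const _
    · rw [interior_Ico]
      exact fun M hM => (hderiv M hM).differentiableAt.differentiableWithinAt
    · rw [interior_Ico]
      intro M hM
      rw [(hderiv M hM).deriv]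
      have hpos := pos M ⟨hM.1.le, hM.2⟩
      have hle := mul_le_mul_of_nonneg_right (hY' M hM) (Real.rpow_nonneg hpos.le (-p))
      rw [mul_assoc, ← Real.rpow_add hpos, add_neg_cancel, Real.rpow_zero, mul_one] at hle
      have hexp : -(p - 1) - 1 = -p := by ring
      have hcancel : deriv Y M * (-(p - 1)) * (δ + Y M) ^ (-p) / (p - 1)
          = -(deriv Y M * (δ + Y M) ^ (-p)) := by
        field_simp
      rw [hexp, hcancel]
      linarith
  refine le_of_forall_lt_imp_le_of_dense fun M hM => ?_
  rcases le_or_gt M 1 with h | h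
  · exact h.trans (Real.one_le_exp (by positivity))
  rw [← Real.log_le_iff_le_exp (by linarith)]
  have h1 : (1 : ℝ) ∈ Ico (1 : ℝ) T := ⟨le_rfl, hT⟩
  have hMem : M ∈ Ico (1 : ℝ) T := ⟨h.le, hM⟩
  have hG := hanti h1 hMem h.le
  simp only [Real.log_one, zero_add] at hG
  have hnonneg : 0 ≤ (δ + Y M) ^ (-(p - 1)) / (p - 1) :=
    div_nonneg (Real.rpow_nonneg (pos M hMem).le _) hp'.le
  have hinit : (δ + Y 1) ^ (-(p - 1)) / (p - 1) ≤ δ ^ (-(p - 1)) / (p - 1) :=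
    div_le_div_of_nonneg_right
      (Real.rpow_le_rpow_of_nonpos hδ (by linarith [hY0 1 h1]) (by linarith)) hp'.le
  linarith
end
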